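/- Let w be a smooth non-negative function on ℝ supported on the interval (1,2) with bounded derivatives. For every sufficiently small ε > 0 there exists a constant C = C(ε, w) such that for every real K ≥ 2 and all positive integers α, β, γ, r₁, r₂ with K^{−ε} < r₁/r₂ < K^{ε}, the quantity E₁ = (1/(πK)) ∑_{k ≥ 2 even} ∑' T(k; n, m, c₁, c₂), where ∑' runs over positive integers n, m, c₁, c₂ with n r₁/c₂ > K^{2−ε}, satisfies |E₁| ≤ C K^{−1/13}. -/

import Mathlib

noncomputable section

/-- e(x) = exp(2πi x) -/
def ee (x : ℝ) : ℂ := Complex.exp (2 * Real.pi * Complex.I * x)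

/-- Bessel function of integer order: J_ℓ(x) = ∫_{-1/2}^{1/2} e(ℓt) e^{-ix sin(2πt)} dt -/
def besselJ (ℓ : ℕ) (x : ℝ) : ℂ :=
  ∫ t in (-(1:ℝ)/2)..(1/2), ee (ℓ * t) * Complex.exp (-Complex.I * x * Real.sin (2 * Real.pi * t))

/-- Kloosterman sum S(n,m;c) -/
def kloos (n m : ℤ) (c : ℕ) : ℂ :=
  ∑ b ∈ Finset.range c, if Nat.Coprime b c then
    ee (((((n : ZMod c) * (b : ZMod c) + (m : ZMod c) * (b : ZMod c)⁻¹).val : ℕ) : ℝ) / c)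
  else 0

/-- Λ_{k,j}(s) -/
def Lam (j : ℕ) (k : ℝ) (s : ℂ) : ℂ :=
  if j = 1 then (2 * Real.pi : ℂ) ^ (-s) * Complex.Gamma (s + (k : ℂ) - 1/2)
  else 8 * (2 * Real.pi : ℂ) ^ (-3*s - 3*(k:ℂ) + 3/2) * Complex.Gamma (s + 2*(k:ℂ) - 3/2) *
    Complex.Gamma (s + (k:ℂ) - 1/2) * Complex.Gamma (s + 1/2)

/-- V_{k,j}(ξ), contour integral on Re s = 1 -/
def V (j : ℕ) (k : ℝ) (ξ : ℝ) : ℂ :=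
  (1 / (2 * Real.pi * Complex.I)) * ∫ t : ℝ,
    (Lam j k (1/2 + (1 + (t:ℂ) * Complex.I)) / Lam j k (1/2)) *
      (ξ : ℂ) ^ (-(1 + (t:ℂ) * Complex.I)) / (1 + (t:ℂ) * Complex.I) * Complex.I

/-- Fourier transform ĥ(t) = ∫ h(v) e(−vt) dv -/
def fhat (h : ℝ → ℂ) (t : ℝ) : ℂ := ∫ v : ℝ, h v * ee (-(v * t))

end

noncomputable section

/-- The summand T(k; n, m, c₁, c₂) from the paper. -/
def T (w : ℝ → ℝ) (K : ℝ) (α β γ r₁ r₂ : ℕ) (k n m c₁ c₂ : ℕ) : ℂ :=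
  Complex.I ^ k *
  ((w ((k : ℝ) / K) * (((k : ℝ) - 1) / K) / Real.sqrt ((n : ℝ) * m) : ℝ) : ℂ) *
  (kloos ((n : ℤ) ^ 2) ((r₁ : ℤ) ^ 2) c₂ / (c₂ : ℂ)) *
  (kloos ((n : ℤ) * α * β ^ 2) (m : ℤ) c₁ / (c₁ : ℂ)) *
  besselJ (k - 1) (4 * Real.pi * n * r₁ / c₂) *
  besselJ (2 * k - 1) (4 * Real.pi * Real.sqrt ((n : ℝ) * m * α * β ^ 2) / c₁) *
  V 1 (k : ℝ) (m : ℝ) *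
  V 2 (k : ℝ) ((n : ℝ) * r₂ ^ 2 * α ^ 3 * β ^ 2 * γ ^ 2)

/-- The condition n r₁ / c₂ > K^{2-ε} defining E₁. -/
def cond1 (K ε : ℝ) (r₁ n c₂ : ℕ) : Prop :=
  (n : ℝ) * r₁ / c₂ > K ^ ((2:ℝ) - ε)

/-- The condition defining E₂. -/
def cond2 (K ε : ℝ) (α β r₁ n m c₁ c₂ : ℕ) : Prop :=
  K ^ ((4:ℝ)/3 - ε) < (n : ℝ) * r₁ / c₂ ∧ (n : ℝ) * r₁ / c₂ < K ^ ((2:ℝ) - ε) ∧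
  (n : ℝ) * r₁ / (c₂ * K ^ ε) < Real.sqrt ((n : ℝ) * m * α * β ^ 2) / c₁ ∧
  Real.sqrt ((n : ℝ) * m * α * β ^ 2) / c₁ < (n : ℝ) * r₁ * K ^ ε / c₂

end


section
open MeasureTheory

lemma ee_eq (x : ℝ) : ee x = Complex.exp (((2 * Real.pi * x : ℝ) : ℂ) * Complex.I) := by
  unfold ee; congr 1; push_cast; ring

lemma norm_ee (x : ℝ) : ‖ee x‖ = 1 := by
  rw [ee_eq]; exact Complex.norm_exp_ofReal_mul_I _

lemma ee_add (x y : ℝ) : ee (x + y) = ee x * ee y := by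
  simp only [ee_eq, ← Complex.exp_add]; congr 1; push_cast; ring

lemma ee_nat (n : ℕ) : ee n = 1 := by
  unfold ee
  rw [show (2 * (Real.pi : ℂ) * Complex.I * ((n : ℝ) : ℂ)) = n * (2 * Real.pi * Complex.I) by push_cast; ring]
  exact Complex.exp_nat_mul_two_pi_mul_I n

lemma continuous_ee : Continuous ee := by unfold ee; fun_prop

/-- the oscillating factor -/
noncomputable def osc (x t : ℝ) : ℂ := Complex.exp (-Complex.I * x * Real.sin (2 * Real.pi * t))

lemma norm_osc (x t : ℝ) : ‖osc x t‖ = 1 := by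
  unfold osc
  rw [show -Complex.I * (x:ℂ) * (Real.sin (2 * Real.pi * t) : ℂ) = ((-(x * Real.sin (2 * Real.pi * t)) : ℝ) : ℂ) * Complex.I by push_cast; ring]
  exact Complex.norm_exp_ofReal_mul_I _

lemma continuous_osc (x : ℝ) : Continuous (osc x) := by unfold osc; fun_prop

lemma besselJ_eq (l : ℕ) (x : ℝ) : besselJ l x = ∫ t in (-(1:ℝ)/2)..(1/2), ee (l * t) * osc x t := rfl

lemma cont_integrand (a x : ℝ) : Continuous (fun t : ℝ => ee (a * t) * osc x t) :=
  (continuous_ee.comp (by fun_prop)).mul (continuous_osc x)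

lemma norm_besselJ_le (l : ℕ) (x : ℝ) : ‖besselJ l x‖ ≤ 1 := by
  rw [besselJ_eq]
  have := intervalIntegral.norm_integral_le_of_norm_le_const (a := -(1:ℝ)/2) (b := 1/2) (C := 1)
    (f := fun t : ℝ => ee (l * t) * osc x t) (by intro t _; simp [norm_ee, norm_osc])
  refine this.trans ?_
  norm_num

lemma hasDerivAt_int (a x t : ℝ) : HasDerivAt (fun t : ℝ => ee (a * t) * osc x t)
    (2 * Real.pi * Complex.I * (a - x * Complex.cos (2 * Real.pi * t)) * (ee (a * t) * osc x t)) t := by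
  have h1 : HasDerivAt (fun t : ℝ => (2 * Real.pi * Complex.I * (a * t) + (-Complex.I * x * Complex.sin (2 * Real.pi * t)) : ℂ))
      (2 * Real.pi * Complex.I * (a - x * Complex.cos (2 * Real.pi * t))) t := by
    have e1 : HasDerivAt (fun z : ℂ => (2 * Real.pi * Complex.I * (a * z) + (-Complex.I * x * Complex.sin (2 * Real.pi * z)) : ℂ))
      (2 * Real.pi * Complex.I * (a - x * Complex.cos (2 * Real.pi * t))) (t : ℂ) := by
      have h2 : HasDerivAt (fun z : ℂ => 2 * (Real.pi : ℂ) * z) (2 * Real.pi) (t : ℂ) := by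
        simpa using (hasDerivAt_id (t : ℂ)).const_mul (2 * (Real.pi : ℂ))
      have h3 := ((Complex.hasDerivAt_sin (2 * Real.pi * (t:ℂ))).comp (t : ℂ) h2).const_mul (-Complex.I * x)
      have h4 := (((hasDerivAt_id (t : ℂ)).const_mul (a : ℂ)).const_mul (2 * (Real.pi : ℂ) * Complex.I))
      refine (h4.add h3).congr_deriv ?_
      ring
    exact e1.comp_ofReal
  have h2 := h1.cexp
  have : (fun t : ℝ => ee (a * t) * osc x t) = fun t : ℝ => Complex.exp (2 * Real.pi * Complex.I * (a * t) + (-Complex.I * x * Complex.sin (2 * Real.pi * t)) : ℂ) := by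
    funext t
    simp only [ee, osc, ← Complex.exp_add]
    push_cast; rfl
  rw [this]
  refine h2.congr_deriv ?_
  rw [show ee (a * t) * osc x t = Complex.exp (2 * Real.pi * Complex.I * (a * t) + (-Complex.I * x * Complex.sin (2 * Real.pi * t)) : ℂ) from congrFun this t]
  ring

lemma besselJ_rec (l : ℕ) (x : ℝ) :
    (x : ℂ) * (besselJ l x + besselJ (l + 2) x) = 2 * (l + 1) * besselJ (l + 1) x := by
  have hI : ∀ a : ℝ, IntervalIntegrable (fun t : ℝ => ee (a * t) * osc x t) volume (-(1:ℝ)/2) (1/2) :=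
    fun a => (cont_integrand a x).intervalIntegrable _ _
  have hd : ∫ t in (-(1:ℝ)/2)..(1/2), (2 * Real.pi * Complex.I * (((l + 1 : ℕ) : ℝ) - x * Complex.cos (2 * Real.pi * t)) * (ee (((l + 1 : ℕ) : ℝ) * t) * osc x t)) = 0 := by
    rw [intervalIntegral.integral_eq_sub_of_hasDerivAt (f := fun t : ℝ => ee (((l + 1 : ℕ) : ℝ) * t) * osc x t)]
    · have e1 : osc x (1/2) = 1 := by
        unfold osc; rw [show 2 * Real.pi * (1/2) = Real.pi by ring]; simp
      have e2 : osc x (-1/2) = 1 := by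
        unfold osc; rw [show 2 * Real.pi * (-1/2) = -Real.pi by ring]; simp
      simp only [e1, e2, mul_one]
      rw [show ((l + 1 : ℕ) : ℝ) * (1/2) = ((l + 1 : ℕ) : ℝ) * (-1/2) + ((l+1 : ℕ) : ℝ) by ring, ee_add, ee_nat]
      ring
    · intro t _; exact hasDerivAt_int _ _ _
    · apply Continuous.intervalIntegrable
      have := cont_integrand ((l + 1 : ℕ) : ℝ) x
      fun_prop
  have key : ∀ t : ℝ, (2 * Real.pi * Complex.I * (((l + 1 : ℕ) : ℝ) - x * Complex.cos (2 * Real.pi * t)) * (ee (((l + 1 : ℕ) : ℝ) * t) * osc x t))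
      = (2 * Real.pi * Complex.I * (l + 1)) * (ee (((l + 1 : ℕ) : ℝ) * t) * osc x t)
        - (Real.pi * Complex.I * x) * (ee ((l : ℝ) * t) * osc x t + ee (((l + 2 : ℕ) : ℝ) * t) * osc x t) := by
    intro t
    have e1 : Complex.cos (2 * Real.pi * t) = (ee t + ee (-t)) / 2 := by
      rw [Complex.cos, ee_eq, ee_eq]; push_cast; congr 2; congr 1; ring
    have e2 : ee (((l + 1 : ℕ) : ℝ) * t) * ee t = ee (((l + 2 : ℕ) : ℝ) * t) := by
      rw [← ee_add]; congr 1; push_cast; ring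
    have e3 : ee (((l + 1 : ℕ) : ℝ) * t) * ee (-t) = ee ((l : ℝ) * t) := by
      rw [← ee_add]; congr 1; push_cast; ring
    rw [e1, ← e2, ← e3]; push_cast; ring
  simp_rw [key] at hd
  rw [intervalIntegral.integral_sub ((hI _).const_mul _) (((hI _).add (hI _)).const_mul _),
    intervalIntegral.integral_const_mul, intervalIntegral.integral_const_mul,
    intervalIntegral.integral_add (hI _) (hI _), ← besselJ_eq, ← besselJ_eq, ← besselJ_eq] at hd
  have hpi : (Real.pi : ℂ) * Complex.I ≠ 0 := by simp [Real.pi_ne_zero]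
  apply mul_left_cancel₀ hpi
  linear_combination -hd

lemma conj_ee (x : ℝ) : (starRingEnd ℂ) (ee x) = ee (-x) := by
  rw [ee_eq, ee_eq, ← Complex.exp_conj]; congr 1
  rw [map_mul, Complex.conj_ofReal, Complex.conj_I]; push_cast; ring

lemma conj_osc (x t : ℝ) : (starRingEnd ℂ) (osc x t) = osc x (-t) := by
  unfold osc; rw [← Complex.exp_conj]; congr 1
  rw [show 2 * Real.pi * -t = -(2 * Real.pi * t) by ring, Real.sin_neg]
  simp only [map_mul, map_neg, Complex.conj_I, Complex.conj_ofReal]; push_cast; ring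

lemma besselJ_conj (l : ℕ) (x : ℝ) : (starRingEnd ℂ) (besselJ l x) = besselJ l x := by
  have h1 : (starRingEnd ℂ) (besselJ l x) = ∫ t in (-(1:ℝ)/2)..(1/2), ee (l * (-t)) * osc x (-t) := by
    rw [besselJ_eq, intervalIntegral.integral_of_le (by norm_num), ← integral_conj,
      intervalIntegral.integral_of_le (by norm_num)]
    simp only [map_mul, conj_ee, conj_osc, mul_neg]
  rw [h1, intervalIntegral.integral_comp_neg (fun t => ee (l * t) * osc x t), besselJ_eq]
  norm_num [neg_div]

lemma besselJ_re (l : ℕ) (x : ℝ) : besselJ l x = ((besselJ l x).re : ℂ) :=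
  (Complex.conj_eq_iff_re.mp (besselJ_conj l x)).symm

lemma norm_besselJ (l : ℕ) (x : ℝ) : ‖besselJ l x‖ = |(besselJ l x).re| := by
  rw [besselJ_re l x]; simp

lemma bessel_re_rec (l : ℕ) (x : ℝ) :
    x * ((besselJ l x).re + (besselJ (l + 2) x).re) = 2 * (l + 1) * (besselJ (l + 1) x).re := by
  have := besselJ_rec l x
  rw [besselJ_re l, besselJ_re (l+2), besselJ_re (l+1)] at this
  exact_mod_cast this
end


section
open MeasureTheory

lemma bessel_ineq (x : ℝ) (N : ℕ) : ∑ l ∈ Finset.range N, (besselJ l x).re ^ 2 ≤ 1 := by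
  have hab : (-(1:ℝ)/2) < 1/2 := by norm_num
  have hL2 : MemLp (osc x) 2 (volume.restrict (Set.Ioc (-(1:ℝ)/2) (1/2))) := by
    apply MemLp.of_bound (continuous_osc x).aestronglyMeasurable 1
    filter_upwards with t; rw [norm_osc]
  have h := hasSum_sq_fourierCoeffOn hab hL2
  have e : ∀ l : ℕ, fourierCoeffOn hab (osc x) (-(l:ℤ)) = besselJ l x := by
    intro l
    rw [fourierCoeffOn_eq_integral, besselJ_eq]
    rw [show (1:ℝ) / (1/2 - -1/2) = 1 by norm_num, one_smul]
    apply intervalIntegral.integral_congr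
    intro t _
    simp only [fourier_coe_apply, smul_eq_mul]
    congr 1
    rw [ee]
    congr 1
    push_cast; norm_num; ring
  have h1 : ((1/2 - (-(1:ℝ)/2))⁻¹ • ∫ t in (-(1:ℝ)/2)..(1/2), ‖osc x t‖ ^ 2) = 1 := by
    simp only [norm_osc]; norm_num
  rw [h1] at h
  have h2 := sum_le_hasSum ((Finset.range N).map ⟨fun l : ℕ => -(l:ℤ), fun a b h => by simpa using h⟩)
    (fun i _ => by positivity) h
  rw [Finset.sum_map] at h2
  refine le_trans (le_of_eq ?_) h2
  apply Finset.sum_congr rfl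
  intro l _
  have := e l
  change _ = ‖fourierCoeffOn hab (osc x) (-(l:ℤ))‖ ^ 2
  rw [this, norm_besselJ, sq_abs]

lemma ratio_chain (Q : ℕ → ℝ) (N : ℕ) (r : ℝ) (hr : 1 ≤ r) (hQ : ∀ i < N, 0 ≤ Q i)
    (h1 : ∀ i, i + 1 < N → Q (i+1) ≤ r * Q i) (h2 : ∀ i, i + 1 < N → Q i ≤ r * Q (i+1)) :
    ∀ a < N, ∀ b < N, Q a ≤ r ^ N * Q b := by
  have up : ∀ d a, a + d < N → Q (a + d) ≤ r ^ d * Q a ∧ Q a ≤ r ^ d * Q (a + d) := by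
    intro d
    induction d with
    | zero => intro a _; simp
    | succ d ih =>
      intro a ha
      obtain ⟨i1, i2⟩ := ih a (by omega)
      have j1 := h1 (a + d) (by omega)
      have j2 := h2 (a + d) (by omega)
      have hp : 0 ≤ r ^ d := by positivity
      have hr0 : 0 ≤ r := by linarith
      constructor
      · calc Q (a + d + 1) ≤ r * Q (a + d) := j1
          _ ≤ r * (r ^ d * Q a) := by gcongr
          _ = _ := by ring
      · calc Q a ≤ r ^ d * Q (a + d) := i2
          _ ≤ r ^ d * (r * Q (a + d + 1)) := by gcongr
          _ = _ := by ring_nf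
  intro a ha b hb
  have hmono : ∀ d ≤ N, r ^ d ≤ r ^ N := fun d hd => pow_le_pow_right₀ hr hd
  rcases le_total a b with hab | hab
  · obtain ⟨d, rfl⟩ := Nat.exists_eq_add_of_le hab
    exact (up d a hb).2.trans (mul_le_mul_of_nonneg_right (hmono d (by omega)) (hQ _ hb))
  · obtain ⟨d, rfl⟩ := Nat.exists_eq_add_of_le hab
    exact (up d b ha).1.trans (mul_le_mul_of_nonneg_right (hmono d (by omega)) (hQ _ hb))

lemma bessel_sq_bound (x : ℝ) (hx : 4 ≤ x) (l : ℕ) (hl : 2 * ((l:ℝ) + 1) ≤ x) :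
    (besselJ l x).re ^ 2 ≤ 216 / x := by
  set j : ℕ → ℝ := fun l => (besselJ l x).re with hj
  have hx0 : 0 < x := by linarith
  set Q : ℕ → ℝ := fun i => j (i+1) ^ 2 + j i ^ 2 - (2 * ((i:ℝ)+1) / x) * (j (i+1) * j i) with hQdef
  set N := ⌊x/2⌋₊ with hN
  have hNx : (N : ℝ) ≤ x / 2 := Nat.floor_le (by positivity)
  have hNx' : x / 2 < N + 1 := Nat.lt_floor_add_one _
  have hb : ∀ i < N, (2 * ((i:ℝ)+1) / x) ≤ 1 := by
    intro i hi
    have : (i:ℝ) + 1 ≤ N := by exact_mod_cast hi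
    rw [div_le_one hx0]; linarith
  have hlow : ∀ i < N, (j (i+1) ^ 2 + j i ^ 2) / 2 ≤ Q i := by
    intro i hi
    have h1 := hb i hi
    have h0 : 0 ≤ (2 * ((i:ℝ)+1) / x) := by positivity
    simp only [hQdef]
    set u := (2 * ((i:ℝ)+1) / x)
    nlinarith [sq_nonneg (j (i+1) - j i), sq_nonneg (j (i+1) + j i), mul_nonneg h0 (sq_nonneg (j (i+1) - j i)),
      mul_nonneg (sub_nonneg.2 h1) (sq_nonneg (j (i+1))), mul_nonneg (sub_nonneg.2 h1) (sq_nonneg (j i))]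
  have hupp : ∀ i < N, Q i ≤ 3/2 * (j (i+1) ^ 2 + j i ^ 2) := by
    intro i hi
    have h1 := hb i hi
    have h0 : 0 ≤ (2 * ((i:ℝ)+1) / x) := by positivity
    simp only [hQdef]
    set u := (2 * ((i:ℝ)+1) / x)
    nlinarith [sq_nonneg (j (i+1) - j i), sq_nonneg (j (i+1) + j i), mul_nonneg h0 (sq_nonneg (j (i+1) + j i)),
      mul_nonneg (sub_nonneg.2 h1) (sq_nonneg (j (i+1))), mul_nonneg (sub_nonneg.2 h1) (sq_nonneg (j i))]
  have hstep : ∀ i, Q (i+1) = Q i - (2 / x) * (j (i+2) * j (i+1)) := by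
    intro i
    have hr := bessel_re_rec i x
    have hr' : j (i+2) = (2 * ((i:ℝ)+1) / x) * j (i+1) - j i := by
      simp only [hj]; field_simp; linarith
    simp only [hQdef]
    rw [show i + 1 + 1 = i + 2 from rfl, hr']
    push_cast
    field_simp
    ring
  have hab : ∀ i < N, |j (i+1) * j i| ≤ Q i := by
    intro i hi
    refine le_trans ?_ (hlow i hi)
    rw [abs_le]; constructor <;> nlinarith [sq_nonneg (j (i+1) - j i), sq_nonneg (j (i+1) + j i)]
  have hQ0 : ∀ i < N, 0 ≤ Q i := fun i hi => (abs_nonneg _).trans (hab i hi)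
  have hx4 : 2 / x ≤ 1/2 := by rw [div_le_div_iff₀ hx0 (by norm_num)]; linarith
  have hx40 : 0 < 2 / x := by positivity
  have hrr : (1:ℝ) ≤ 1 + 4 / x := by have : 0 < 4 / x := by positivity
                                     linarith
  have h4 : 4 / x = 2 * (2 / x) := by ring
  have chain := ratio_chain Q N (1 + 4/x) hrr hQ0
    (by
      intro i hi
      have h1 := hstep i
      have h2 := abs_le.1 (hab (i+1) hi)
      have h3 := hQ0 (i+1) hi
      rw [h4]
      set d := 2 / x
      have : Q (i+1) ≤ Q i + d * Q (i+1) := by nlinarith [h2.1]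
      have : Q (i+1) * (1 - d) ≤ Q i := by linarith
      nlinarith [mul_nonneg (mul_nonneg hx40.le (by linarith : 0 ≤ 1/2 - d)) h3])
    (by
      intro i hi
      have h1 := hstep i
      have h2 := abs_le.1 (hab (i+1) hi)
      have h3 := hQ0 (i+1) hi
      rw [h4]
      set d := 2 / x
      nlinarith [h2.2])
  have hlN : l < N := by
    have : (l : ℝ) + 1 ≤ x / 2 := by linarith
    have : l + 1 ≤ N := Nat.le_floor (by push_cast; exact this)
    omega
  have hpow : (1 + 4/x) ^ N ≤ 9 := by
    have h1 : (1 + 4/x) ^ N ≤ Real.exp (4/x) ^ N := by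
      apply pow_le_pow_left₀ (by linarith)
      have := Real.add_one_le_exp (4/x); linarith
    rw [← Real.exp_nat_mul] at h1
    refine h1.trans ?_
    have h2 : (N:ℝ) * (4/x) ≤ 2 := by
      calc (N:ℝ) * (4/x) ≤ x/2 * (4/x) := by gcongr
        _ = 2 := by field_simp; norm_num
    refine (Real.exp_le_exp.2 h2).trans ?_
    have h3 := Real.exp_one_lt_d9
    rw [show (2:ℝ) = 1 + 1 by norm_num, Real.exp_add]
    nlinarith [Real.exp_pos 1]
  have hsum : (N : ℝ) * Q l ≤ 27 := by
    have h1 : ∑ b ∈ Finset.range N, Q l ≤ ∑ b ∈ Finset.range N, 9 * (3/2 * (j (b+1) ^ 2 + j b ^ 2)) := by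
      apply Finset.sum_le_sum
      intro b hb
      rw [Finset.mem_range] at hb
      refine (chain l hlN b hb).trans ?_
      exact mul_le_mul hpow (hupp b hb) (hQ0 b hb) (by norm_num)
    rw [Finset.sum_const, Finset.card_range, nsmul_eq_mul, ← Finset.mul_sum, ← Finset.mul_sum, Finset.sum_add_distrib] at h1
    have b1 := bessel_ineq x N
    have b2 := bessel_ineq x (N+1)
    rw [Finset.sum_range_succ'] at b2
    have b3 : 0 ≤ (besselJ 0 x).re ^ 2 := sq_nonneg _
    simp only [hj] at h1
    linarith
  have hNl : x / 4 ≤ N := by linarith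
  have hl2 := hlow l hlN
  have hq : x / 4 * Q l ≤ 27 := (mul_le_mul_of_nonneg_right hNl (hQ0 l hlN)).trans hsum
  rw [le_div_iff₀ hx0]
  have : j l ^ 2 ≤ 2 * Q l := by nlinarith [sq_nonneg (j (l+1))]
  calc j l ^ 2 * x ≤ 2 * Q l * x := by gcongr
    _ ≤ 216 := by linarith

lemma bessel_bound (x : ℝ) (hx : 4 ≤ x) (l : ℕ) (hl : 2 * ((l:ℝ) + 1) ≤ x) :
    ‖besselJ l x‖ ≤ 15 * x ^ (-(1/2) : ℝ) := by
  have h := bessel_sq_bound x hx l hl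
  have hx0 : 0 < x := by linarith
  rw [norm_besselJ]
  refine abs_le_of_sq_le_sq ?_ (by positivity)
  have : (x ^ (-(1/2) : ℝ)) ^ 2 = 1 / x := by
    rw [← Real.rpow_natCast, ← Real.rpow_mul hx0.le]; norm_num [Real.rpow_neg_one]
  rw [mul_pow, this]
  refine h.trans ?_
  rw [mul_one_div]; gcongr; norm_num

lemma geom_bound (N : ℕ) (t : ℝ) (ht : |t| ≤ 1/2) :
    ‖∑ l ∈ Finset.range N, ee (l * t)‖ ≤ 2 * N / (1 + N * |t|) := by
  have hN0 : (0:ℝ) ≤ N := Nat.cast_nonneg N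
  have hd : 0 < 1 + N * |t| := by positivity
  rw [le_div_iff₀ hd]
  have hA : ‖∑ l ∈ Finset.range N, ee (l * t)‖ ≤ N := by
    refine (norm_sum_le _ _).trans ?_
    simp [norm_ee]
  have hB : ‖∑ l ∈ Finset.range N, ee (l * t)‖ * |t| ≤ 1 := by
    have e : ∀ l : ℕ, ee (l * t) = ee t ^ l := by
      intro l; rw [ee, ee, ← Complex.exp_nat_mul]; congr 1; push_cast; ring
    simp_rw [e]
    have g := geom_sum_mul (ee t) N
    have g2 : ‖∑ l ∈ Finset.range N, ee t ^ l‖ * ‖ee t - 1‖ ≤ 2 := by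
      rw [← norm_mul, g]
      refine (norm_sub_le _ _).trans ?_
      rw [norm_pow, norm_ee]; norm_num
    have g3 : 4 * |t| ≤ ‖ee t - 1‖ := by
      rw [ee_eq, mul_comm _ Complex.I, Complex.norm_exp_I_mul_ofReal_sub_one]
      rw [show 2 * Real.pi * t / 2 = Real.pi * t by ring]
      rw [norm_mul, Real.norm_eq_abs, Real.norm_eq_abs, abs_two]
      have : 2 * |t| ≤ |Real.sin (Real.pi * t)| := by
        have hp := Real.pi_pos
        have := Real.mul_le_sin (x := Real.pi * |t|) (by positivity) (by nlinarith)
        have e2 : 2 / Real.pi * (Real.pi * |t|) = 2 * |t| := by field_simp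
        rw [e2] at this
        rcases abs_cases t with ⟨h1, _⟩ | ⟨h1, _⟩
        · rw [h1] at this ⊢; exact this.trans (le_abs_self _)
        · rw [h1] at this ⊢; rw [mul_neg Real.pi, Real.sin_neg] at this
          exact this.trans (neg_le_abs _)
      linarith
    have h0 : 0 ≤ ‖∑ l ∈ Finset.range N, ee t ^ l‖ := norm_nonneg _
    nlinarith [mul_le_mul_of_nonneg_left g3 h0]
  nlinarith

lemma continuous_geom (N : ℕ) : Continuous fun t : ℝ => ∑ l ∈ Finset.range N, ee (l * t) :=
  continuous_finsetSum _ fun l _ => continuous_ee.comp (by fun_prop)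

lemma geom_L1 (N : ℕ) : ∫ t in (-(1:ℝ)/2)..(1/2), ‖∑ l ∈ Finset.range N, ee (l * t)‖ ≤ 4 * Real.log (1 + N) := by
  have hN0 : (0:ℝ) ≤ N := Nat.cast_nonneg N
  have hc : Continuous fun t : ℝ => 2 * (N:ℝ) / (1 + N * |t|) := by
    apply Continuous.div (by fun_prop) (by fun_prop)
    intro t; positivity
  have h1 : ∫ t in (-(1:ℝ)/2)..(1/2), ‖∑ l ∈ Finset.range N, ee (l * t)‖ ≤
      ∫ t in (-(1:ℝ)/2)..(1/2), 2 * (N:ℝ) / (1 + N * |t|) := by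
    apply intervalIntegral.integral_mono_on (by norm_num) ((continuous_geom N).norm.intervalIntegrable _ _) (hc.intervalIntegrable _ _)
    intro t ht
    apply geom_bound
    rw [abs_le]; constructor <;> linarith [ht.1, ht.2]
  refine h1.trans ?_
  have hpos : ∫ t in (0:ℝ)..(1/2), 2 * (N:ℝ) / (1 + N * |t|) = 2 * Real.log (1 + N * (1/2)) := by
    have : ∫ t in (0:ℝ)..(1/2), 2 * (N:ℝ) / (1 + N * |t|) = 2 * Real.log (1 + N * (1/2)) - 2 * Real.log (1 + N * 0) := by
      apply intervalIntegral.integral_eq_sub_of_hasDerivAt (f := fun t => 2 * Real.log (1 + N * t))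
      · intro t ht
        rw [Set.uIcc_of_le (by norm_num)] at ht
        rw [abs_of_nonneg ht.1]
        have h2 : HasDerivAt (fun t : ℝ => 1 + (N:ℝ) * t) N t := by
          simpa using ((hasDerivAt_id t).const_mul (N:ℝ)).const_add 1
        have ht0 := ht.1
        have := (h2.log (by positivity)).const_mul 2
        refine this.congr_deriv ?_
        ring
      · exact hc.intervalIntegrable _ _
    rw [this]; simp
  have hneg : ∫ t in (-(1:ℝ)/2)..0, 2 * (N:ℝ) / (1 + N * |t|) = 2 * Real.log (1 + N * (1/2)) := by
    rw [← hpos]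
    have := intervalIntegral.integral_comp_neg (a := 0) (b := 1/2) (fun t : ℝ => 2 * (N:ℝ) / (1 + N * |t|))
    simp only [abs_neg] at this
    rw [this]; norm_num [neg_div]
  rw [← intervalIntegral.integral_add_adjacent_intervals (hc.intervalIntegrable _ 0) (hc.intervalIntegrable 0 _), hpos, hneg]
  have : Real.log (1 + N * (1/2)) ≤ Real.log (1 + N) := Real.log_le_log (by positivity) (by linarith)
  linarith

lemma geom_L1_four (N : ℕ) : ∫ t in (-(1:ℝ)/2)..(1/2), ‖∑ l ∈ Finset.range N, ee (4 * l * t)‖ ≤ 4 * Real.log (1 + N) := by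
  refine le_of_eq_of_le ?_ (geom_L1 N)
  set f : ℝ → ℝ := fun t => ‖∑ l ∈ Finset.range N, ee (l * t)‖ with hf
  have hper : Function.Periodic f 1 := by
    intro t
    simp only [hf]
    congr 1
    apply Finset.sum_congr rfl
    intro l _
    rw [mul_add, mul_one, ee_add, ee_nat, mul_one]
  have e1 : ∀ t : ℝ, ‖∑ l ∈ Finset.range N, ee (4 * l * t)‖ = f (4 * t) := by
    intro t; simp only [hf]; congr 1; apply Finset.sum_congr rfl; intro l _; congr 1; ring
  simp_rw [e1]
  rw [intervalIntegral.integral_comp_mul_left (f := f) (by norm_num : (4:ℝ) ≠ 0)]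
  have hc : Continuous f := (continuous_geom N).norm
  have e2 := hper.intervalIntegral_add_zsmul_eq 4 (-2) (fun a b => hc.intervalIntegrable a b)
  have e3 := hper.intervalIntegral_add_eq (-2) (-(1:ℝ)/2)
  norm_num at e2 e3 ⊢
  rw [e2, e3]
  ring

lemma bessel_partial (N h : ℕ) (y : ℝ) :
    ‖∑ l ∈ Finset.range N, besselJ (4 * l + h) y‖ ≤ 4 * Real.log (1 + N) := by
  have e : ∑ l ∈ Finset.range N, besselJ (4 * l + h) y =
      ∫ t in (-(1:ℝ)/2)..(1/2), (∑ l ∈ Finset.range N, ee (4 * l * t)) * (ee (h * t) * osc y t) := by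
    simp_rw [besselJ_eq]
    rw [← intervalIntegral.integral_finsetSum]
    · congr 1; funext t
      rw [Finset.sum_mul]
      apply Finset.sum_congr rfl
      intro l _
      rw [← mul_assoc, ← ee_add]
      congr 2; push_cast; ring
    · intro l _
      exact (cont_integrand _ y).intervalIntegrable _ _
  rw [e]
  refine (intervalIntegral.norm_integral_le_integral_norm (by norm_num)).trans ?_
  simp only [norm_mul, norm_ee, norm_osc, mul_one]
  exact geom_L1_four N
end


section
open MeasureTheory

lemma norm_cGamma_le (s : ℂ) (hs : 0 < s.re) : ‖Complex.Gamma s‖ ≤ Real.Gamma s.re := by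
  rw [Complex.Gamma_eq_integral hs, Real.Gamma_eq_integral hs, Complex.GammaIntegral]
  refine (norm_integral_le_integral_norm _).trans (le_of_eq ?_)
  apply setIntegral_congr_fun measurableSet_Ioi
  intro x hx
  simp only [norm_mul]
  rw [Complex.norm_of_nonneg (Real.exp_pos _).le, Complex.norm_cpow_eq_rpow_re_of_pos hx]
  simp

lemma gam_decay (n : ℕ) : ∀ s : ℂ, 0 < s.re → ‖s‖ ^ n * ‖Complex.Gamma s‖ ≤ Real.Gamma (s.re + n) := by
  induction n with
  | zero => intro s hs; simpa using norm_cGamma_le s hs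
  | succ n ih =>
    intro s hs
    have hs0 : s ≠ 0 := by rintro rfl; simp at hs
    have h1 := ih (s + 1) (by simp; linarith)
    rw [Complex.Gamma_add_one s hs0, norm_mul] at h1
    have h2 : ‖s‖ ≤ ‖s + 1‖ := by
      rw [Complex.norm_def, Complex.norm_def]
      apply Real.sqrt_le_sqrt
      simp only [Complex.normSq_apply, Complex.add_re, Complex.add_im, Complex.one_re, Complex.one_im]
      nlinarith
    calc ‖s‖ ^ (n+1) * ‖Complex.Gamma s‖ = ‖s‖ ^ n * (‖s‖ * ‖Complex.Gamma s‖) := by ring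
      _ ≤ ‖s + 1‖ ^ n * (‖s‖ * ‖Complex.Gamma s‖) := by gcongr
      _ ≤ Real.Gamma ((s+1).re + n) := h1
      _ = _ := by congr 1; simp; ring

lemma line_re (σ t : ℝ) : ((σ : ℂ) + t * Complex.I).re = σ := by simp

lemma norm_line (σ t : ℝ) (hσ : 1 ≤ σ) : 1 + t ^ 2 ≤ ‖(σ : ℂ) + t * Complex.I‖ ^ 2 := by
  rw [← Complex.normSq_eq_norm_sq, Complex.normSq_add_mul_I]; nlinarith

lemma diff_Gamma_re {s : ℂ} (hs : 0 < s.re) : DifferentiableAt ℂ Complex.Gamma s := by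
  apply Complex.differentiableAt_Gamma
  intro m h
  rw [h] at hs
  simp at hs
  have : (0:ℝ) ≤ m := Nat.cast_nonneg m
  linarith

lemma continuous_Gamma_line (σ : ℝ) (hσ : 0 < σ) : Continuous fun t : ℝ => Complex.Gamma (σ + t * Complex.I) := by
  rw [continuous_iff_continuousAt]
  intro t
  have h : ContinuousAt Complex.Gamma (σ + t * Complex.I) :=
    (diff_Gamma_re (by simpa using hσ)).continuousAt
  exact ContinuousAt.comp (f := fun t : ℝ => (σ : ℂ) + t * Complex.I) h (by fun_prop)

lemma Gamma_line_bound (σ t : ℝ) (hσ : 1 ≤ σ) (n : ℕ) :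
    ‖(σ : ℂ) + t * Complex.I‖ ^ n * ‖Complex.Gamma (σ + t * Complex.I)‖ ≤ Real.Gamma (σ + n + 2) * (1 + t ^ 2)⁻¹ := by
  have h := gam_decay (n + 2) (σ + t * Complex.I) (by simp; linarith)
  rw [line_re] at h
  have h2 := norm_line σ t hσ
  have h3 : 0 < 1 + t ^ 2 := by positivity
  rw [← div_eq_mul_inv, le_div_iff₀ h3]
  push_cast at h
  rw [← add_assoc] at h
  refine le_trans ?_ h
  rw [pow_add]
  calc _ ≤ ‖(σ : ℂ) + t * Complex.I‖ ^ n * ‖Complex.Gamma (σ + t * Complex.I)‖ * ‖(σ : ℂ) + t * Complex.I‖ ^ 2 := by gcongr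
    _ = _ := by ring

lemma Gamma_vert_integrable (σ : ℝ) (hσ : 1 ≤ σ) : Integrable fun t : ℝ => Complex.Gamma (σ + t * Complex.I) := by
  refine (integrable_inv_one_add_sq.const_mul (Real.Gamma (σ + 2))).mono' (continuous_Gamma_line σ (by linarith)).aestronglyMeasurable ?_
  filter_upwards with t
  simpa using Gamma_line_bound σ t hσ 0

lemma mellin_exp_inv (σ : ℝ) (hσ : 1 ≤ σ) (u : ℝ) (hu : 0 < u) :
    ∫ t : ℝ, (u : ℂ) ^ (-((σ : ℂ) + t * Complex.I)) * Complex.Gamma (σ + t * Complex.I) = 2 * Real.pi * (Real.exp (-u) : ℂ) := by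
  have hG : ∀ t : ℝ, mellin (fun x : ℝ => ((Real.exp (-x) : ℝ) : ℂ)) (σ + t * Complex.I) = Complex.Gamma (σ + t * Complex.I) := by
    intro t
    rw [Complex.Gamma_eq_integral (by simp; linarith), Complex.GammaIntegral_eq_mellin]
  have h := mellinInv_mellin_eq σ (fun x : ℝ => ((Real.exp (-x) : ℝ) : ℂ)) hu
    (by
      have := Complex.GammaIntegral_convergent (s := (σ : ℂ)) (by simp; linarith)
      unfold MellinConvergent
      refine this.congr_fun ?_ measurableSet_Ioi
      intro x _
      simp only [smul_eq_mul]; ring)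
    (by
      unfold Complex.VerticalIntegrable
      simp_rw [hG]
      exact Gamma_vert_integrable σ hσ)
    (by fun_prop)
  unfold mellinInv at h
  simp_rw [hG, smul_eq_mul] at h
  rw [← h]
  rw [Complex.real_smul]
  push_cast
  rw [← mul_assoc, mul_one_div_cancel (by simp [Real.pi_ne_zero]), one_mul]

lemma mellin_exp_shift (k : ℕ) (u : ℝ) (hu : 0 < u) :
    ∫ t : ℝ, Complex.Gamma ((1 + (t:ℂ) * Complex.I) + k) * (u : ℂ) ^ (-(1 + (t:ℂ) * Complex.I)) = 2 * Real.pi * (Real.exp (-u) * u ^ k : ℝ) := by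
  have h := mellin_exp_inv (1 + k) (by have : (0:ℝ) ≤ k := Nat.cast_nonneg k
                                       linarith) u hu
  have hu0 : (u : ℂ) ≠ 0 := by exact_mod_cast hu.ne'
  have e : ∀ t : ℝ, Complex.Gamma ((1 + (t:ℂ) * Complex.I) + k) * (u : ℂ) ^ (-(1 + (t:ℂ) * Complex.I))
      = (u : ℂ) ^ k * ((u : ℂ) ^ (-(((1 + k : ℝ) : ℂ) + t * Complex.I)) * Complex.Gamma (((1 + k : ℝ) : ℂ) + t * Complex.I)) := by
    intro t
    rw [show (-(1 + (t:ℂ) * Complex.I)) = (k : ℂ) + (-(((1 + k : ℝ) : ℂ) + t * Complex.I)) by push_cast; ring,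
      Complex.cpow_add _ _ hu0, Complex.cpow_natCast,
      show (1 + (t:ℂ) * Complex.I) + k = ((1 + k : ℝ) : ℂ) + t * Complex.I by push_cast; ring]
    ring
  simp_rw [e]
  rw [integral_const_mul, h]
  push_cast; ring

lemma norm_cpow_line (u σ t : ℝ) (hu : 0 < u) : ‖(u : ℂ) ^ (-((σ : ℂ) + t * Complex.I))‖ = u ^ (-σ) := by
  rw [Complex.norm_cpow_eq_rpow_re_of_pos hu]; simp

lemma continuous_cpow_line (u σ : ℝ) (hu : 0 < u) : Continuous fun t : ℝ => (u : ℂ) ^ (-((σ : ℂ) + t * Complex.I)) := by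
  apply Continuous.const_cpow (by fun_prop)
  left; exact_mod_cast hu.ne'

lemma integrable_shift (k : ℕ) (u : ℝ) (hu : 0 < u) :
    Integrable fun t : ℝ => Complex.Gamma ((1 + (t:ℂ) * Complex.I) + k) * (u : ℂ) ^ (-(1 + (t:ℂ) * Complex.I)) := by
  have hk : (0:ℝ) ≤ k := Nat.cast_nonneg k
  have h1 := Gamma_vert_integrable (1 + k) (by linarith)
  have e : ∀ t : ℝ, ((1 + k : ℝ) : ℂ) + t * Complex.I = (1 + (t:ℂ) * Complex.I) + k := by intro t; push_cast; ring
  simp_rw [e] at h1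
  have hc := continuous_cpow_line u 1 hu
  have := h1.mul_bdd (c := u ^ (-1 : ℝ)) (g := fun t : ℝ => (u : ℂ) ^ (-(((1:ℝ) : ℂ) + t * Complex.I))) hc.aestronglyMeasurable (by
    filter_upwards with t; rw [norm_cpow_line u 1 t hu])
  simpa using this

lemma one_line_ne (t : ℝ) : (1 + (t:ℂ) * Complex.I) ≠ 0 := by
  intro h
  have := congrArg Complex.re h
  simp at this

lemma V1_core (u : ℝ) (hu : 0 < u) (k : ℕ) :
    Integrable (fun t : ℝ => Complex.Gamma ((1 + (t:ℂ) * Complex.I) + (k + 1 : ℕ)) / (1 + (t:ℂ) * Complex.I) * (u : ℂ) ^ (-(1 + (t:ℂ) * Complex.I))) ∧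
    ∫ t : ℝ, Complex.Gamma ((1 + (t:ℂ) * Complex.I) + (k + 1 : ℕ)) / (1 + (t:ℂ) * Complex.I) * (u : ℂ) ^ (-(1 + (t:ℂ) * Complex.I))
      = 2 * Real.pi * (k.factorial * (Real.exp (-u) * ∑ j ∈ Finset.range (k+1), u ^ j / j.factorial) : ℝ) := by
  induction k with
  | zero =>
    have e : ∀ t : ℝ, Complex.Gamma ((1 + (t:ℂ) * Complex.I) + (0 + 1 : ℕ)) / (1 + (t:ℂ) * Complex.I) * (u : ℂ) ^ (-(1 + (t:ℂ) * Complex.I))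
      = Complex.Gamma ((1 + (t:ℂ) * Complex.I) + (0:ℕ)) * (u : ℂ) ^ (-(1 + (t:ℂ) * Complex.I)) := by
      intro t
      have h := one_line_ne t
      push_cast
      rw [add_zero, Complex.Gamma_add_one _ h]
      field_simp
    simp_rw [e]
    refine ⟨integrable_shift 0 u hu, ?_⟩
    rw [mellin_exp_shift 0 u hu]; simp
  | succ k ih =>
    have e : ∀ t : ℝ, Complex.Gamma ((1 + (t:ℂ) * Complex.I) + (k + 1 + 1 : ℕ)) / (1 + (t:ℂ) * Complex.I) * (u : ℂ) ^ (-(1 + (t:ℂ) * Complex.I))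
      = Complex.Gamma ((1 + (t:ℂ) * Complex.I) + (k + 1 : ℕ)) * (u : ℂ) ^ (-(1 + (t:ℂ) * Complex.I))
       + ((k + 1 : ℕ) : ℂ) * (Complex.Gamma ((1 + (t:ℂ) * Complex.I) + (k + 1 : ℕ)) / (1 + (t:ℂ) * Complex.I) * (u : ℂ) ^ (-(1 + (t:ℂ) * Complex.I))) := by
      intro t
      have h := one_line_ne t
      have h2 : (1 + (t:ℂ) * Complex.I) + (k + 1 : ℕ) ≠ 0 := by
        intro h
        have := congrArg Complex.re h
        simp at this
        have hk : (0:ℝ) ≤ k := Nat.cast_nonneg k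
        linarith
      rw [show (1 + (t:ℂ) * Complex.I) + (k + 1 + 1 : ℕ) = ((1 + (t:ℂ) * Complex.I) + (k + 1 : ℕ)) + 1 by push_cast; ring, Complex.Gamma_add_one _ h2]
      field_simp
    simp_rw [e]
    refine ⟨(integrable_shift (k+1) u hu).add (ih.1.const_mul _), ?_⟩
    rw [integral_add (integrable_shift (k+1) u hu) (ih.1.const_mul _), integral_const_mul, ih.2, mellin_exp_shift (k+1) u hu,
      Finset.sum_range_succ _ (k+1), Nat.factorial_succ]
    have : ((k+1).factorial : ℝ) ≠ 0 := by exact_mod_cast (Nat.factorial_pos _).ne'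
    rw [Nat.factorial_succ] at this
    push_cast at this ⊢
    have hc : ((k + 1 : ℂ) * (k.factorial : ℂ)) ≠ 0 := by exact_mod_cast this
    have h1 := left_ne_zero_of_mul hc
    have h2 := right_ne_zero_of_mul hc
    field_simp
    ring

lemma V1_closed (k : ℕ) (hk : 1 ≤ k) (ξ : ℝ) (hξ : 0 < ξ) :
    V 1 k ξ = ((Real.exp (-(2 * Real.pi * ξ)) * ∑ j ∈ Finset.range k, (2 * Real.pi * ξ) ^ j / j.factorial : ℝ) : ℂ) := by
  obtain ⟨k, rfl⟩ := Nat.exists_eq_add_of_le' hk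
  have hu : 0 < 2 * Real.pi * ξ := by have := Real.pi_pos; positivity
  have h := (V1_core _ hu k).2
  unfold V
  have hpi : (Real.pi : ℂ) ≠ 0 := by simp [Real.pi_ne_zero]
  have hkf : ((k.factorial : ℕ) : ℂ) ≠ 0 := by exact_mod_cast (Nat.factorial_pos _).ne'
  have e : ∀ t : ℝ, (Lam 1 ((k+1:ℕ):ℝ) (1/2 + (1 + (t:ℂ) * Complex.I)) / Lam 1 ((k+1:ℕ):ℝ) (1/2)) *
      (ξ : ℂ) ^ (-(1 + (t:ℂ) * Complex.I)) / (1 + (t:ℂ) * Complex.I) * Complex.I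
     = (Complex.I / (k.factorial : ℂ)) * (Complex.Gamma ((1 + (t:ℂ) * Complex.I) + (k + 1 : ℕ)) / (1 + (t:ℂ) * Complex.I) * ((2 * Real.pi * ξ : ℝ) : ℂ) ^ (-(1 + (t:ℂ) * Complex.I))) := by
    intro t
    have h := one_line_ne t
    simp only [Lam, if_true]
    have g1 : Complex.Gamma (1/2 + (((k+1:ℕ):ℝ):ℂ) - 1/2) = (k.factorial : ℂ) := by
      rw [← Complex.Gamma_nat_eq_factorial]; congr 1; push_cast; ring
    have g2 : (1/2 + (1 + (t:ℂ) * Complex.I)) + (((k+1:ℕ):ℝ):ℂ) - 1/2 = (1 + (t:ℂ) * Complex.I) + (k + 1 : ℕ) := by push_cast; ring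
    have h2pi : (2 * (Real.pi : ℂ)) ≠ 0 := by simp [Real.pi_ne_zero]
    have g3 : ((2 * Real.pi * ξ : ℝ) : ℂ) ^ (-(1 + (t:ℂ) * Complex.I)) = (2 * Real.pi : ℂ) ^ (-(1 + (t:ℂ) * Complex.I)) * (ξ : ℂ) ^ (-(1 + (t:ℂ) * Complex.I)) := by
      rw [Complex.ofReal_mul (2 * Real.pi) ξ, Complex.mul_cpow_ofReal_nonneg (by have := Real.pi_pos; positivity) hξ.le]; push_cast; rfl
    have g4 : (2 * Real.pi : ℂ) ^ (-(1/2 + (1 + (t:ℂ) * Complex.I))) = (2 * Real.pi : ℂ) ^ (-(1 + (t:ℂ) * Complex.I)) * (2 * Real.pi : ℂ) ^ (-(1/2) : ℂ) := by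
      rw [← Complex.cpow_add _ _ h2pi]; congr 1; ring
    have g5 : (2 * Real.pi : ℂ) ^ (-(1/2) : ℂ) ≠ 0 := by
      simp [Complex.cpow_eq_zero_iff, Real.pi_ne_zero]
    rw [g1, g2, g3, g4]
    field_simp
  simp_rw [e]
  rw [integral_const_mul, h]
  have hI := Complex.I_ne_zero
  push_cast
  field_simp
end


section
open MeasureTheory

lemma V1_nn (ξ : ℝ) (hξ : 0 < ξ) :
    ∃ v : ℕ → ℝ, (∀ j : ℕ, 1 ≤ j → V 1 j ξ = (v j : ℂ)) ∧ (∀ j, 0 ≤ v j) ∧ Monotone v ∧ (∀ j, v j ≤ 1) ∧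
     (∀ j : ℕ, v j ≤ (((j:ℝ) + 1) / ξ) ^ 2) := by
  have hu : 0 < 2 * Real.pi * ξ := by have := Real.pi_pos; positivity
  refine ⟨fun k => Real.exp (-(2 * Real.pi * ξ)) * ∑ j ∈ Finset.range k, (2 * Real.pi * ξ) ^ j / j.factorial, fun j hj => V1_closed j hj ξ hξ, ?_, ?_, ?_, ?_⟩
  · intro j; positivity
  · apply monotone_nat_of_le_succ
    intro j
    rw [Finset.sum_range_succ, mul_add]
    have : 0 ≤ Real.exp (-(2 * Real.pi * ξ)) * ((2 * Real.pi * ξ) ^ j / j.factorial) := by positivity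
    linarith
  · intro j
    have := Real.sum_le_exp_of_nonneg hu.le j
    calc _ ≤ Real.exp (-(2 * Real.pi * ξ)) * Real.exp (2 * Real.pi * ξ) := mul_le_mul_of_nonneg_left this (Real.exp_pos _).le
      _ = 1 := by rw [← Real.exp_add]; simp
  · intro j
    set u := 2 * Real.pi * ξ with hudef
    have huξ : ξ ≤ u := by have := Real.pi_gt_three; nlinarith
    have h2 := Real.sum_le_exp_of_nonneg hu.le (j+2)
    have h3 : u ^ 2 * ∑ i ∈ Finset.range j, u ^ i / i.factorial ≤ ((j:ℝ)+1)^2 * ∑ i ∈ Finset.range (j+2), u ^ i / i.factorial := by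
      rw [Finset.sum_range_succ', Finset.sum_range_succ', Finset.mul_sum, mul_add, mul_add, Finset.mul_sum]
      have : ∑ i ∈ Finset.range j, u ^ 2 * (u ^ i / i.factorial) ≤ ∑ i ∈ Finset.range j, ((j:ℝ)+1)^2 * (u ^ (i+1+1) / ((i+1+1).factorial : ℕ)) := by
        apply Finset.sum_le_sum
        intro i hi
        have hi' : (i:ℝ) + 1 ≤ j := by exact_mod_cast Finset.mem_range.1 hi
        rw [Nat.factorial_succ, Nat.factorial_succ]
        push_cast
        have hf : (0:ℝ) < i.factorial := by exact_mod_cast Nat.factorial_pos i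
        rw [← mul_div_assoc, ← mul_div_assoc, div_le_div_iff₀ hf (by positivity)]
        have : (((i:ℝ)+1+1)*((i:ℝ)+1)) ≤ ((j:ℝ)+1)^2 := by
          have : (0:ℝ) ≤ i := Nat.cast_nonneg i
          nlinarith
        calc _ = (u ^ (i+2) * i.factorial) * (((i:ℝ)+1+1)*((i:ℝ)+1)) := by ring
          _ ≤ (u ^ (i+2) * i.factorial) * ((j:ℝ)+1)^2 := by gcongr
          _ = _ := by ring
      have p1 : 0 ≤ ((j:ℝ)+1)^2 * (u ^ (0 + 1) / (((0 + 1).factorial : ℕ) : ℝ)) := by positivity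
      have p2 : 0 ≤ ((j:ℝ)+1)^2 * (u ^ 0 / ((Nat.factorial 0 : ℕ) : ℝ)) := by positivity
      linarith
    have h4 : u ^ 2 * (Real.exp (-u) * ∑ i ∈ Finset.range j, u ^ i / i.factorial) ≤ ((j:ℝ)+1)^2 := by
      calc _ = Real.exp (-u) * (u ^ 2 * ∑ i ∈ Finset.range j, u ^ i / i.factorial) := by ring
        _ ≤ Real.exp (-u) * (((j:ℝ)+1)^2 * Real.exp u) := by
            refine mul_le_mul_of_nonneg_left (h3.trans (mul_le_mul_of_nonneg_left h2 (by positivity))) (Real.exp_pos _).le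
        _ = ((j:ℝ)+1)^2 * Real.exp (-u + u) := by rw [Real.exp_add]; ring
        _ = _ := by simp
    have h5 : Real.exp (-u) * ∑ i ∈ Finset.range j, u ^ i / i.factorial ≤ ((j + 1) / u) ^ 2 := by
      rw [div_pow, le_div_iff₀ (by positivity)]; linarith
    refine h5.trans ?_
    gcongr

lemma shift_line (F : ℂ → ℂ) (hF : DifferentiableOn ℂ F {s | 0 < s.re}) (M : ℝ)
    (hM : ∀ σ t : ℝ, 1 ≤ σ → σ ≤ 3 → ‖F (σ + t * Complex.I)‖ ≤ M * (1 + t^2)⁻¹) :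
    ∫ t : ℝ, F (1 + t * Complex.I) = ∫ t : ℝ, F (3 + t * Complex.I) := by
  have cont : ∀ σ : ℝ, 1 ≤ σ → Continuous fun t : ℝ => F (σ + t * Complex.I) := by
    intro σ hσ
    apply hF.continuousOn.comp_continuous (by fun_prop)
    intro t; simp; linarith
  have integ : ∀ σ : ℝ, 1 ≤ σ → σ ≤ 3 → Integrable fun t : ℝ => F (σ + t * Complex.I) := by
    intro σ h1 h3
    refine (integrable_inv_one_add_sq.const_mul M).mono' (cont σ h1).aestronglyMeasurable ?_
    filter_upwards with t
    exact hM σ t h1 h3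
  have lim : ∀ σ : ℝ, 1 ≤ σ → σ ≤ 3 → Filter.Tendsto (fun T : ℝ => ∫ t in (-T)..T, F (σ + t * Complex.I)) Filter.atTop (nhds (∫ t : ℝ, F (σ + t * Complex.I))) :=
    fun σ h1 h3 => intervalIntegral_tendsto_integral (integ σ h1 h3) Filter.tendsto_neg_atTop_atBot Filter.tendsto_id
  have L := (lim 3 (by norm_num) le_rfl).sub (lim 1 le_rfl (by norm_num))
  have rect : ∀ T : ℝ, ‖(∫ t in (-T)..T, F ((3:ℝ) + t * Complex.I)) - ∫ t in (-T)..T, F ((1:ℝ) + t * Complex.I)‖ ≤ 4 * M * (1 + T^2)⁻¹ := by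
    intro T
    have h := Complex.integral_boundary_rect_eq_zero_of_differentiableOn F (⟨1, -T⟩ : ℂ) (⟨3, T⟩ : ℂ) (hF.mono (by
      intro s hs
      have := hs.1
      simp only [Set.mem_preimage] at this
      rw [Set.uIcc_of_le (by norm_num)] at this
      have := this.1
      simp only [Set.mem_ofPred_eq]
      linarith))
    simp only [smul_eq_mul] at h
    have b1 : ‖∫ x in (1:ℝ)..3, F (x + ((-T : ℝ) : ℂ) * Complex.I)‖ ≤ M * (1 + T^2)⁻¹ * |3 - 1| := by
      apply intervalIntegral.norm_integral_le_of_norm_le_const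
      intro x hx
      rw [Set.uIoc_of_le (by norm_num)] at hx
      have := hM x (-T) hx.1.le hx.2
      simpa using this
    have b2 : ‖∫ x in (1:ℝ)..3, F (x + (T : ℂ) * Complex.I)‖ ≤ M * (1 + T^2)⁻¹ * |3 - 1| := by
      apply intervalIntegral.norm_integral_le_of_norm_le_const
      intro x hx
      rw [Set.uIoc_of_le (by norm_num)] at hx
      exact hM x T hx.1.le hx.2
    have e : Complex.I * ((∫ t in (-T)..T, F ((3:ℝ) + t * Complex.I)) - ∫ t in (-T)..T, F ((1:ℝ) + t * Complex.I))
      = (∫ x in (1:ℝ)..3, F (x + (T : ℂ) * Complex.I)) - ∫ x in (1:ℝ)..3, F (x + ((-T : ℝ) : ℂ) * Complex.I) := by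
      linear_combination h
    have e2 := congrArg norm e
    rw [norm_mul, Complex.norm_I, one_mul] at e2
    rw [e2]
    refine (norm_sub_le _ _).trans ?_
    have : |(3:ℝ) - 1| = 2 := by norm_num
    rw [this] at b1 b2
    linarith
  have Z : Filter.Tendsto (fun T : ℝ => 4 * M * (1 + T^2)⁻¹) Filter.atTop (nhds 0) := by
    rw [show (0:ℝ) = 4 * M * 0 by ring]
    apply Filter.Tendsto.const_mul
    apply Filter.Tendsto.inv_tendsto_atTop
    exact Filter.tendsto_atTop_add_const_left _ _ (Filter.tendsto_pow_atTop (by norm_num))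
  have L2 := squeeze_zero_norm rect Z
  have := tendsto_nhds_unique L L2
  have := (sub_eq_zero.1 this).symm
  simpa using this
end


section
open MeasureTheory

noncomputable def Ph (k : ℕ) (s : ℂ) : ℂ :=
  Complex.Gamma (s + (2 * k - 1 : ℝ)) * Complex.Gamma (s + (k:ℝ)) / (Complex.Gamma ((2 * k - 1 : ℝ):ℂ) * Complex.Gamma ((k:ℝ):ℂ))

lemma cube_cpow (a : ℝ) (ha : 0 ≤ a) (z : ℂ) : ((a ^ 3 : ℝ) : ℂ) ^ z = ((a : ℂ) ^ z) ^ 3 := by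
  rw [show a ^ 3 = a * (a * a) by ring, Complex.ofReal_mul, Complex.mul_cpow_ofReal_nonneg ha (by positivity),
    Complex.ofReal_mul, Complex.mul_cpow_ofReal_nonneg ha ha]
  ring

lemma V2_line (k : ℕ) (hk : 1 ≤ k) (ξ : ℝ) (hξ : 0 < ξ) :
    V 2 k ξ = (1 / (2 * Real.pi)) * ∫ t : ℝ, Ph k (1 + t * Complex.I) * Complex.Gamma (1 + t * Complex.I) * (((2 * Real.pi)^3 * ξ : ℝ) : ℂ) ^ (-(1 + (t:ℂ) * Complex.I)) := by
  unfold V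
  have hpi : (Real.pi : ℂ) ≠ 0 := by simp [Real.pi_ne_zero]
  have e : ∀ t : ℝ, (Lam 2 (k:ℝ) (1/2 + (1 + (t:ℂ) * Complex.I)) / Lam 2 (k:ℝ) (1/2)) *
      (ξ : ℂ) ^ (-(1 + (t:ℂ) * Complex.I)) / (1 + (t:ℂ) * Complex.I) * Complex.I
     = Complex.I * (Ph k (1 + t * Complex.I) * Complex.Gamma (1 + t * Complex.I) * (((2 * Real.pi)^3 * ξ : ℝ) : ℂ) ^ (-(1 + (t:ℂ) * Complex.I))) := by
    intro t
    have h := one_line_ne t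
    set s := (1 + (t:ℂ) * Complex.I) with hs
    simp only [Lam, Ph, show ¬ ((2:ℕ) = 1) by norm_num, if_false]
    have h2pi : (2 * (Real.pi : ℂ)) ≠ 0 := by simp [Real.pi_ne_zero]
    have g3 : (((2 * Real.pi)^3 * ξ : ℝ) : ℂ) ^ (-s) = (2 * Real.pi : ℂ) ^ (-3 * s) * (ξ : ℂ) ^ (-s) := by
      rw [Complex.ofReal_mul ((2 * Real.pi)^3) ξ, Complex.mul_cpow_ofReal_nonneg (by have := Real.pi_pos; positivity) hξ.le]
      congr 1
      have := Real.pi_pos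
      have h0 : (0:ℝ) ≤ 2 * Real.pi := by positivity
      rw [show -3 * s = (3:ℕ) * (-s) by push_cast; ring, Complex.cpow_nat_mul, cube_cpow _ h0]
      push_cast
      rfl
    have g4 : (2 * Real.pi : ℂ) ^ (-3 * (1/2 + s) - 3 * ((k:ℝ):ℂ) + 3/2) = (2 * Real.pi : ℂ) ^ (-3 * s) * (2 * Real.pi : ℂ) ^ (-3 * (1/2) - 3 * ((k:ℝ):ℂ) + 3/2 : ℂ) := by
      rw [← Complex.cpow_add _ _ h2pi]; congr 1; ring
    have g5 : (2 * Real.pi : ℂ) ^ (-3 * (1/2) - 3 * ((k:ℝ):ℂ) + 3/2 : ℂ) ≠ 0 := by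
      rw [Complex.cpow_ne_zero_iff]; left; exact h2pi
    have g6 : (1/2 + s + 1/2) = s + 1 := by ring
    have g7 : (1/2 + 1/2 : ℂ) = 1 := by norm_num
    have g8 : 1/2 + s + 2 * ((k:ℝ):ℂ) - 3/2 = s + ((2 * k - 1 : ℝ) : ℂ) := by push_cast; ring
    have g9 : 1/2 + 2 * ((k:ℝ):ℂ) - 3/2 = ((2 * k - 1 : ℝ) : ℂ) := by push_cast; ring
    have g10 : 1/2 + s + ((k:ℝ):ℂ) - 1/2 = s + ((k:ℝ):ℂ) := by ring
    have g11 : 1/2 + ((k:ℝ):ℂ) - 1/2 = ((k:ℝ):ℂ) := by ring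
    rw [g3, g4, g6, g7, g8, g9, g10, g11, Complex.Gamma_add_one _ h, Complex.Gamma_one]
    field_simp
  simp_rw [e]
  rw [integral_const_mul]
  have hI := Complex.I_ne_zero
  field_simp

lemma V2_line3 (k : ℕ) (hk : 1 ≤ k) (ξ : ℝ) (hξ : 0 < ξ) :
    V 2 k ξ = (1 / (2 * Real.pi)) * ∫ t : ℝ, Ph k (3 + t * Complex.I) * Complex.Gamma (3 + t * Complex.I) * (((2 * Real.pi)^3 * ξ : ℝ) : ℂ) ^ (-(3 + (t:ℂ) * Complex.I)) := by
  rw [V2_line k hk ξ hξ]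
  congr 1
  have hk' : (1:ℝ) ≤ k := by exact_mod_cast hk
  set u := (2 * Real.pi)^3 * ξ with hu
  have hu0 : 0 < u := by have := Real.pi_pos; positivity
  have hu0' : (u:ℂ) ≠ 0 := by exact_mod_cast hu0.ne'
  set D := Complex.Gamma ((2 * k - 1 : ℝ):ℂ) * Complex.Gamma ((k:ℝ):ℂ) with hD
  have hc : ContinuousOn (fun σ : ℝ => Real.Gamma (σ + (2 * k - 1)) * Real.Gamma (σ + k) / ‖D‖ * Real.Gamma (σ + 2) * u ^ (-σ)) (Set.Icc 1 3) := by
    have hG : ∀ a : ℝ, 0 ≤ a → ContinuousOn (fun σ : ℝ => Real.Gamma (σ + a)) (Set.Icc 1 3) := by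
      intro a ha
      apply ContinuousOn.comp (t := Set.Ioi 0) (g := Real.Gamma)
      · exact Real.differentiableOn_Gamma_Ioi.continuousOn
      · fun_prop
      · intro x hx
        have := hx.1
        simp; linarith
    have h1 := hG (2 * k - 1) (by linarith)
    have h2 := hG k (by linarith)
    have h3 := hG 2 (by norm_num)
    have h4 : Continuous fun σ : ℝ => u ^ (-σ) := by
      apply Continuous.rpow continuous_const (by fun_prop)
      intro x; left; exact hu0.ne'
    exact (((h1.mul h2).div_const _).mul h3).mul h4.continuousOn
  obtain ⟨M, hM⟩ := isCompact_Icc.exists_bound_of_continuousOn hc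
  apply shift_line (fun s => Ph k s * Complex.Gamma s * (u:ℂ) ^ (-s)) ?_ M
  · intro σ t h1 h3
    have hb := hM σ ⟨h1, h3⟩
    have hb := (le_abs_self _).trans hb
    have e1 : ‖Complex.Gamma (σ + t * Complex.I + (2 * k - 1 : ℝ))‖ ≤ Real.Gamma (σ + (2 * k - 1)) := by
      have := norm_cGamma_le (σ + t * Complex.I + (2 * k - 1 : ℝ)) (by rw [Complex.add_re, line_re, Complex.ofReal_re]; linarith)
      rwa [Complex.add_re, line_re, Complex.ofReal_re] at this
    have e2 : ‖Complex.Gamma (σ + t * Complex.I + (k : ℝ))‖ ≤ Real.Gamma (σ + k) := by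
      have := norm_cGamma_le (σ + t * Complex.I + (k : ℝ)) (by rw [Complex.add_re, line_re, Complex.ofReal_re]; linarith)
      rwa [Complex.add_re, line_re, Complex.ofReal_re] at this
    have e3 := Gamma_line_bound σ t h1 0
    simp only [pow_zero, one_mul, Nat.cast_zero, add_zero] at e3
    have p1 := (norm_nonneg _).trans e1
    have p2 := (norm_nonneg _).trans e2
    have e4 := norm_cpow_line u σ t hu0
    have p4 : 0 ≤ u ^ (-σ) := by positivity
    rw [norm_mul, norm_mul, e4, Ph, norm_div, norm_mul]
    calc _ ≤ Real.Gamma (σ + (2 * k - 1)) * Real.Gamma (σ + k) / ‖D‖ * (Real.Gamma (σ + 2) * (1 + t^2)⁻¹) * u ^ (-σ) := by gcongr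
      _ = (Real.Gamma (σ + (2 * k - 1)) * Real.Gamma (σ + k) / ‖D‖ * Real.Gamma (σ + 2) * u ^ (-σ)) * (1 + t^2)⁻¹ := by ring
      _ ≤ _ := by gcongr
  · intro s hs
    have hs : 0 < s.re := hs
    apply DifferentiableAt.differentiableWithinAt
    have d1 : DifferentiableAt ℂ (fun s : ℂ => Complex.Gamma (s + (2 * k - 1 : ℝ))) s :=
      DifferentiableAt.comp s (g := Complex.Gamma) (diff_Gamma_re (by rw [Complex.add_re, Complex.ofReal_re]; linarith)) (by fun_prop)
    have d2 : DifferentiableAt ℂ (fun s : ℂ => Complex.Gamma (s + (k : ℝ))) s :=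
      DifferentiableAt.comp s (g := Complex.Gamma) (diff_Gamma_re (by rw [Complex.add_re, Complex.ofReal_re]; linarith)) (by fun_prop)
    have d3 : DifferentiableAt ℂ (fun s : ℂ => (u:ℂ) ^ (-s)) s := by
      apply DifferentiableAt.const_cpow (by fun_prop)
      left; exact hu0'
    exact (((d1.mul d2).div_const _).mul (diff_Gamma_re hs)).mul d3
end


section
open MeasureTheory

lemma norm_Ph (k : ℕ) (hk : 1 ≤ k) (t : ℝ) : ‖Ph k (3 + t * Complex.I)‖ ≤ 72 * (k:ℝ)^6 := by
  have hk' : (1:ℝ) ≤ k := by exact_mod_cast hk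
  have e1 : ‖Complex.Gamma (3 + t * Complex.I + (2 * k - 1 : ℝ))‖ ≤ Real.Gamma (3 + (2 * k - 1)) := by
    have := norm_cGamma_le ((3:ℝ) + t * Complex.I + (2 * k - 1 : ℝ)) (by rw [Complex.add_re, line_re, Complex.ofReal_re]; linarith)
    rw [Complex.add_re, line_re, Complex.ofReal_re] at this
    simpa using this
  have e2 : ‖Complex.Gamma (3 + t * Complex.I + (k : ℝ))‖ ≤ Real.Gamma (3 + k) := by
    have := norm_cGamma_le ((3:ℝ) + t * Complex.I + (k : ℝ)) (by rw [Complex.add_re, line_re, Complex.ofReal_re]; linarith)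
    rw [Complex.add_re, line_re, Complex.ofReal_re] at this
    simpa using this
  have g1 : Real.Gamma (3 + (2 * k - 1)) = (2*k+1)*(2*k)*(2*k-1) * Real.Gamma (2 * k - 1) := by
    rw [show (3 + (2 * (k:ℝ) - 1)) = ((2 * k - 1) + 1) + 1 + 1 by ring, Real.Gamma_add_one (by linarith), Real.Gamma_add_one (by linarith), Real.Gamma_add_one (by linarith)]
    ring
  have g2 : Real.Gamma (3 + k) = (k+2)*(k+1)*k * Real.Gamma k := by
    rw [show (3 + (k:ℝ)) = (k + 1) + 1 + 1 by ring, Real.Gamma_add_one (by linarith), Real.Gamma_add_one (by linarith), Real.Gamma_add_one (by linarith)]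
    ring
  have p1 : 0 < Real.Gamma (2 * k - 1) := Real.Gamma_pos_of_pos (by linarith)
  have p2 : 0 < Real.Gamma k := Real.Gamma_pos_of_pos (by linarith)
  rw [Ph, norm_div, norm_mul, norm_mul, Complex.Gamma_ofReal, Complex.Gamma_ofReal, Complex.norm_real, Complex.norm_real,
    Real.norm_of_nonneg p1.le, Real.norm_of_nonneg p2.le, div_le_iff₀ (by positivity)]
  rw [g1] at e1
  rw [g2] at e2
  have q1 : (2*(k:ℝ)+1)*(2*k)*(2*k-1) ≤ (3*k)*(2*k)*(2*k) := by
    have : 0 ≤ 2 * (k:ℝ) - 1 := by linarith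
    gcongr <;> linarith
  have q2 : ((k:ℝ)+2)*(k+1)*k ≤ (3*k)*(2*k)*k := by gcongr <;> linarith
  calc _ ≤ ((2*k+1)*(2*k)*(2*k-1) * Real.Gamma (2 * k - 1)) * ((k+2)*(k+1)*k * Real.Gamma k) := by
        gcongr
        exact (norm_nonneg _).trans e1
    _ ≤ ((3*k)*(2*k)*(2*k) * Real.Gamma (2 * k - 1)) * ((3*k)*(2*k)*k * Real.Gamma k) := by gcongr
    _ = _ := by ring

lemma Ph_succ (k : ℕ) (hk : 1 ≤ k) (s : ℂ) (hs : 0 < s.re) :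
    Ph (k+1) s = Ph k s * ((1 + s / (2 * k - 1)) * (1 + s / (2 * k)) * (1 + s / k)) := by
  have hk' : (1:ℝ) ≤ k := by exact_mod_cast hk
  have ne : ∀ a : ℝ, 0 ≤ a → s + a ≠ 0 := by
    intro a ha h
    have := congrArg Complex.re h
    rw [Complex.add_re, Complex.ofReal_re, Complex.zero_re] at this; linarith
  have ne' : ∀ a : ℝ, 0 < a → (a:ℂ) ≠ 0 := fun a ha => by exact_mod_cast ha.ne'
  unfold Ph
  have a1 : Complex.Gamma (s + (2 * (k+1:ℕ) - 1 : ℝ)) = (s + (2*k:ℝ)) * ((s + (2*k-1:ℝ)) * Complex.Gamma (s + (2*k-1:ℝ))) := by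
    rw [← Complex.Gamma_add_one _ (ne _ (by linarith)), show (s + (2*k-1:ℝ)) + 1 = s + (2*k:ℝ) by push_cast; ring, ← Complex.Gamma_add_one _ (ne _ (by linarith))]
    congr 1; push_cast; ring
  have a2 : Complex.Gamma (s + ((k+1:ℕ):ℝ)) = (s + (k:ℝ)) * Complex.Gamma (s + (k:ℝ)) := by
    rw [← Complex.Gamma_add_one _ (ne _ (by linarith))]
    congr 1; push_cast; ring
  have a3 : Complex.Gamma (((2 * (k+1:ℕ) - 1 : ℝ)):ℂ) = ((2*k:ℝ):ℂ) * (((2*k-1:ℝ):ℂ) * Complex.Gamma ((2*k-1:ℝ):ℂ)) := by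
    rw [← Complex.Gamma_add_one _ (ne' _ (by linarith)), show ((2*k-1:ℝ):ℂ) + 1 = ((2*k:ℝ):ℂ) by push_cast; ring, ← Complex.Gamma_add_one _ (ne' _ (by linarith))]
    congr 1; push_cast; ring
  have a4 : Complex.Gamma (((k+1:ℕ):ℝ):ℂ) = ((k:ℝ):ℂ) * Complex.Gamma ((k:ℝ):ℂ) := by
    rw [← Complex.Gamma_add_one _ (ne' _ (by linarith))]
    congr 1; push_cast; ring
  rw [a1, a2, a3, a4]
  have n1 := ne' (2*k-1) (by linarith)
  have n2 := ne' k (by linarith)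
  have n3 : Complex.Gamma ((2*k-1:ℝ):ℂ) ≠ 0 := Complex.Gamma_ne_zero_of_re_pos (by rw [Complex.ofReal_re]; linarith)
  have n4 : Complex.Gamma ((k:ℝ):ℂ) ≠ 0 := Complex.Gamma_ne_zero_of_re_pos (by rw [Complex.ofReal_re]; linarith)
  push_cast at n1 n2 n3 n4 ⊢
  field_simp
  ring

lemma prod_sub_one (a b c : ℂ) (r : ℝ) (ha : ‖a‖ ≤ r) (hb : ‖b‖ ≤ r) (hc : ‖c‖ ≤ r) :
    ‖(1 + a) * (1 + b) * (1 + c) - 1‖ ≤ 3 * r + 3 * r^2 + r^3 := by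
  have h0 := (norm_nonneg _).trans ha
  rw [show (1 + a) * (1 + b) * (1 + c) - 1 = (a + b + c) + (a * b + a * c + b * c) + a * b * c by ring]
  have h1 : ‖a + b + c‖ ≤ r + r + r := (norm_add₃_le).trans (by gcongr)
  have h2 : ‖a * b + a * c + b * c‖ ≤ r*r + r*r + r*r := by
    refine (norm_add₃_le).trans ?_
    rw [norm_mul, norm_mul, norm_mul]
    gcongr
  have h3 : ‖a * b * c‖ ≤ r * r * r := by rw [norm_mul, norm_mul]; gcongr
  calc _ ≤ ‖a + b + c‖ + ‖a * b + a * c + b * c‖ + ‖a * b * c‖ := norm_add₃_le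
    _ ≤ _ := by nlinarith

lemma Ph_diff (k : ℕ) (hk : 1 ≤ k) (t : ℝ) :
    ‖Ph (k+1) (3 + t * Complex.I) - Ph k (3 + t * Complex.I)‖ ≤ 504 * (k:ℝ)^5 * ‖(3 + t * Complex.I : ℂ)‖ ^ 3 := by
  have hk' : (1:ℝ) ≤ k := by exact_mod_cast hk
  set s : ℂ := 3 + t * Complex.I with hs
  have hre : s.re = 3 := by simp [hs]
  rw [Ph_succ k hk s (by rw [hre]; norm_num)]
  rw [show Ph k s * ((1 + s / (2 * k - 1)) * (1 + s / (2 * k)) * (1 + s / k)) - Ph k s = Ph k s * ((1 + s / (2 * k - 1)) * (1 + s / (2 * k)) * (1 + s / k) - 1) by ring, norm_mul]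
  have hn : 1 ≤ ‖s‖ := by
    have := Complex.abs_re_le_norm s
    rw [hre] at this; norm_num at this; linarith
  have b : ∀ a : ℝ, (k:ℝ) ≤ a → ‖s / (a:ℂ)‖ ≤ ‖s‖ / k := by
    intro a ha
    rw [norm_div, Complex.norm_real, Real.norm_of_nonneg (by linarith)]
    gcongr
  have b1 := b (2 * k - 1) (by linarith)
  have b2 := b (2 * k) (by linarith)
  have b3 := b k le_rfl
  push_cast at b1 b2 b3
  have h := prod_sub_one _ _ _ _ b1 b2 b3
  have h2 : 3 * (‖s‖ / k) + 3 * (‖s‖ / k)^2 + (‖s‖ / k)^3 ≤ 7 * ‖s‖^3 / k := by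
    have i1 : ‖s‖ / k ≤ ‖s‖^3 / k := by
      gcongr
      calc ‖s‖ = ‖s‖^1 := by ring
        _ ≤ ‖s‖^3 := pow_le_pow_right₀ hn (by norm_num)
    have i2 : (‖s‖ / k)^2 ≤ ‖s‖^3 / k := by
      rw [div_pow]
      apply div_le_div₀ (by positivity) (pow_le_pow_right₀ hn (by norm_num)) (by positivity)
      nlinarith
    have i3 : (‖s‖ / k)^3 ≤ ‖s‖^3 / k := by
      rw [div_pow]
      apply div_le_div₀ (by positivity) le_rfl (by positivity)
      have : (1:ℝ) ≤ k^2 := one_le_pow₀ hk'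
      nlinarith
    have : 7 * ‖s‖^3 / k = 7 * (‖s‖^3 / k) := by ring
    rw [this]; linarith
  calc _ ≤ (72 * (k:ℝ)^6) * (7 * ‖s‖^3 / k) := by
        gcongr
        · exact norm_Ph k hk t
        · exact h.trans h2
    _ = _ := by field_simp; norm_num

lemma int_bound (F : ℝ → ℂ) (M : ℝ) (h : ∀ t, ‖F t‖ ≤ M * (1 + t^2)⁻¹) : ‖∫ t, F t‖ ≤ M * Real.pi := by
  have := norm_integral_le_of_norm_le (integrable_inv_one_add_sq.const_mul M) (f := F) (by filter_upwards with t; exact h t)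
  rwa [integral_const_mul, integral_univ_inv_one_add_sq] at this

lemma cpow3_bound (ξ t : ℝ) (hξ : 0 < ξ) : ‖(((2 * Real.pi)^3 * ξ : ℝ) : ℂ) ^ (-(3 + (t:ℂ) * Complex.I))‖ ≤ 1 / ξ ^ 3 := by
  have hpi := Real.pi_gt_three
  have h := norm_cpow_line ((2 * Real.pi)^3 * ξ) 3 t (by positivity)
  push_cast at h ⊢
  rw [h, Real.rpow_neg (by positivity), ← one_div, show ((3:ℝ)) = ((3:ℕ):ℝ) by norm_num, Real.rpow_natCast]
  have : ξ ≤ (2 * Real.pi)^3 * ξ := by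
    have : 1 ≤ (2 * Real.pi)^3 := one_le_pow₀ (by linarith)
    nlinarith
  gcongr

lemma Gamma3 (n : ℕ) (t : ℝ) : ‖(3 + t * Complex.I : ℂ)‖^n * ‖Complex.Gamma (3 + t * Complex.I)‖ ≤ Real.Gamma (n + 5) * (1 + t^2)⁻¹ := by
  have := Gamma_line_bound 3 t (by norm_num) n
  rw [show (3 + (n:ℝ) + 2) = n + 5 by ring] at this
  simpa using this

lemma Ph_cont (k : ℕ) (hk : 1 ≤ k) : Continuous fun t : ℝ => Ph k (3 + t * Complex.I) := by
  have hk' : (1:ℝ) ≤ k := by exact_mod_cast hk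
  have h1 := continuous_Gamma_line (3 + (2*k-1)) (by linarith)
  have h2 := continuous_Gamma_line (3 + k) (by linarith)
  have := (h1.mul h2).div_const (Complex.Gamma ((2 * k - 1 : ℝ):ℂ) * Complex.Gamma ((k:ℝ):ℂ))
  convert this using 2 with t
  unfold Ph
  simp only [Pi.mul_apply]
  congr 3
  · push_cast; ring
  · push_cast; ring

lemma V2_integrable (k : ℕ) (hk : 1 ≤ k) (ξ : ℝ) (hξ : 0 < ξ) :
    (∀ t : ℝ, ‖Ph k (3 + t * Complex.I) * Complex.Gamma (3 + t * Complex.I) * (((2 * Real.pi)^3 * ξ : ℝ) : ℂ) ^ (-(3 + (t:ℂ) * Complex.I))‖ ≤ (72 * 24 * (k:ℝ)^6 / ξ^3) * (1 + t^2)⁻¹) ∧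
    Integrable fun t : ℝ => Ph k (3 + t * Complex.I) * Complex.Gamma (3 + t * Complex.I) * (((2 * Real.pi)^3 * ξ : ℝ) : ℂ) ^ (-(3 + (t:ℂ) * Complex.I)) := by
  have hpi := Real.pi_gt_three
  have B : (∀ t : ℝ, ‖Ph k (3 + t * Complex.I) * Complex.Gamma (3 + t * Complex.I) * (((2 * Real.pi)^3 * ξ : ℝ) : ℂ) ^ (-(3 + (t:ℂ) * Complex.I))‖ ≤ (72 * 24 * (k:ℝ)^6 / ξ^3) * (1 + t^2)⁻¹) := by
    intro t
    have g := Gamma3 0 t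
    have g5 : Real.Gamma ((0:ℕ) + 5) = 24 := by
      rw [show (((0:ℕ):ℝ) + 5) = (4:ℕ) + 1 by norm_num, Real.Gamma_nat_eq_factorial]; norm_num [Nat.factorial]
    rw [g5, pow_zero, one_mul] at g
    rw [norm_mul, norm_mul]
    calc _ ≤ (72 * (k:ℝ)^6) * (24 * (1 + t^2)⁻¹) * (1 / ξ^3) := by
          gcongr
          · exact norm_Ph k hk t
          · exact cpow3_bound ξ t hξ
      _ = _ := by ring
  refine ⟨B, (integrable_inv_one_add_sq.const_mul _).mono' (Continuous.aestronglyMeasurable ?_) (by filter_upwards with t; exact B t)⟩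
  have c1 := Ph_cont k hk
  have c2 := continuous_Gamma_line 3 (by norm_num)
  have c3 := continuous_cpow_line ((2 * Real.pi)^3 * ξ) 3 (by positivity)
  push_cast at c2 c3 ⊢
  exact (c1.mul c2).mul c3

lemma V2_bound (k : ℕ) (hk : 1 ≤ k) (ξ : ℝ) (hξ : 0 < ξ) : ‖V 2 k ξ‖ ≤ 864 * (k:ℝ)^6 / ξ^3 := by
  have hpi := Real.pi_gt_three
  rw [V2_line3 k hk ξ hξ, norm_mul]
  have := int_bound _ _ (V2_integrable k hk ξ hξ).1
  have e : ‖(1 / (2 * Real.pi) : ℂ)‖ = 1 / (2 * Real.pi) := by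
    rw [show (1 / (2 * Real.pi) : ℂ) = ((1 / (2 * Real.pi) : ℝ) : ℂ) by push_cast; rfl, Complex.norm_real, Real.norm_of_nonneg (by positivity)]
  rw [e]
  calc _ ≤ 1 / (2 * Real.pi) * ((72 * 24 * (k:ℝ)^6 / ξ^3) * Real.pi) := by gcongr
    _ = _ := by field_simp; norm_num

lemma V2_diff (k : ℕ) (hk : 1 ≤ k) (ξ : ℝ) (hξ : 0 < ξ) : ‖V 2 (k+1:ℕ) ξ - V 2 k ξ‖ ≤ 1270080 * (k:ℝ)^5 / ξ^3 := by
  have hpi := Real.pi_gt_three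
  rw [V2_line3 k hk ξ hξ, V2_line3 (k+1) (by omega) ξ hξ, ← mul_sub, ← integral_sub (V2_integrable (k+1) (by omega) ξ hξ).2 (V2_integrable k hk ξ hξ).2, norm_mul]
  have e : ‖(1 / (2 * Real.pi) : ℂ)‖ = 1 / (2 * Real.pi) := by
    rw [show (1 / (2 * Real.pi) : ℂ) = ((1 / (2 * Real.pi) : ℝ) : ℂ) by push_cast; rfl, Complex.norm_real, Real.norm_of_nonneg (by positivity)]
  rw [e]
  have := int_bound (fun t : ℝ => Ph (k+1) (3 + t * Complex.I) * Complex.Gamma (3 + t * Complex.I) * (((2 * Real.pi)^3 * ξ : ℝ) : ℂ) ^ (-(3 + (t:ℂ) * Complex.I)) - Ph k (3 + t * Complex.I) * Complex.Gamma (3 + t * Complex.I) * (((2 * Real.pi)^3 * ξ : ℝ) : ℂ) ^ (-(3 + (t:ℂ) * Complex.I))) (504 * 5040 * (k:ℝ)^5 / ξ^3) (by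
    intro t
    have g := Gamma3 3 t
    have g5 : Real.Gamma ((3:ℕ) + 5) = 5040 := by
      rw [show (((3:ℕ):ℝ) + 5) = (7:ℕ) + 1 by norm_num, Real.Gamma_nat_eq_factorial]; norm_num [Nat.factorial]
    rw [g5] at g
    rw [← sub_mul, ← sub_mul, norm_mul, norm_mul]
    calc _ ≤ (504 * (k:ℝ)^5 * ‖(3 + t * Complex.I : ℂ)‖ ^ 3) * ‖Complex.Gamma (3 + t * Complex.I)‖ * (1 / ξ^3) := by
          gcongr
          · exact Ph_diff k hk t
          · exact cpow3_bound ξ t hξ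
      _ = (504 * (k:ℝ)^5 / ξ^3) * (‖(3 + t * Complex.I : ℂ)‖ ^ 3 * ‖Complex.Gamma (3 + t * Complex.I)‖) := by ring
      _ ≤ (504 * (k:ℝ)^5 / ξ^3) * (5040 * (1 + t^2)⁻¹) := by gcongr
      _ = _ := by ring)
  calc _ ≤ 1 / (2 * Real.pi) * ((504 * 5040 * (k:ℝ)^5 / ξ^3) * Real.pi) := by gcongr
    _ = _ := by field_simp; norm_num
end


section

lemma ee_val (c : ℕ) [NeZero c] (x : ZMod c) : ee (((x.val : ℕ) : ℝ) / c) = ZMod.stdAddChar x := by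
  rw [ZMod.stdAddChar_apply, ZMod.toCircle_apply]
  unfold ee
  congr 1
  push_cast; ring

lemma norm_kloos_le (n m : ℤ) (c : ℕ) : ‖kloos n m c‖ ≤ c := by
  unfold kloos
  refine (norm_sum_le _ _).trans ?_
  have : ∀ b ∈ Finset.range c, ‖(if Nat.Coprime b c then
    ee (((((n : ZMod c) * (b : ZMod c) + (m : ZMod c) * (b : ZMod c)⁻¹).val : ℕ) : ℝ) / c) else 0 : ℂ)‖ ≤ 1 := by
    intro b _
    split_ifs
    · rw [norm_ee]
    · simp
  refine (Finset.sum_le_sum this).trans ?_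
  simp

lemma kloos_mod (n : ℤ) (c j r : ℕ) : kloos n ((c * j + r : ℕ) : ℤ) c = kloos n (r : ℤ) c := by
  unfold kloos
  push_cast
  simp

lemma kloos_parseval (n : ℤ) (c : ℕ) (hc : 1 ≤ c) : ∑ r ∈ Finset.range c, ‖kloos n (r : ℤ) c‖ ^ 2 ≤ (c:ℝ) ^ 2 := by
  have : NeZero c := ⟨by omega⟩
  set S := (Finset.range c).filter (fun b => Nat.Coprime b c) with hS
  set g : ℕ → ZMod c := fun b => (b : ZMod c)⁻¹ with hg
  set a : ℕ → ℂ := fun b => ZMod.stdAddChar ((n : ZMod c) * (b : ZMod c)) with ha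
  have na : ∀ b, ‖a b‖ = 1 := by
    intro b; simp [ha]
  have inj : ∀ b ∈ S, ∀ b' ∈ S, g b = g b' → b = b' := by
    intro b hb b' hb' h
    simp only [hS, Finset.mem_filter, Finset.mem_range] at hb hb'
    have h1 := ZMod.coe_mul_inv_eq_one b hb.2
    have h2 := ZMod.coe_mul_inv_eq_one b' hb'.2
    have h3 : (b : ZMod c) = b' := by
      simp only [hg] at h
      calc (b : ZMod c) = b * (b' * (b':ZMod c)⁻¹) := by rw [h2, mul_one]
        _ = b' * (b * (b:ZMod c)⁻¹) := by rw [h]; ring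
        _ = b' := by rw [h1, mul_one]
    rw [ZMod.natCast_eq_natCast_iff', Nat.mod_eq_of_lt hb.1, Nat.mod_eq_of_lt hb'.1] at h3
    exact h3
  have k1 : ∀ r : ℕ, kloos n (r : ℤ) c = ∑ b ∈ S, a b * ZMod.stdAddChar ((r : ZMod c) * g b) := by
    intro r
    unfold kloos
    rw [hS, Finset.sum_filter]
    apply Finset.sum_congr rfl
    intro b _
    split_ifs
    · rw [ee_val, AddChar.map_add_eq_mul]
      simp [ha, hg]
    · rfl
  have main : (((∑ r ∈ Finset.range c, ‖kloos n (r : ℤ) c‖ ^ 2 : ℝ)) : ℂ) = (c : ℂ) * S.card := by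
    push_cast
    have e1 : ∀ r : ℕ, ((‖kloos n (r : ℤ) c‖ : ℂ) ^ 2) = (fun x : ZMod c => ∑ b ∈ S, ∑ b' ∈ S, (a b * (starRingEnd ℂ) (a b')) * ZMod.stdAddChar (x * (g b - g b'))) (r : ZMod c) := by
      intro r
      rw [← Complex.mul_conj', k1 r, map_sum, Finset.sum_mul_sum]
      apply Finset.sum_congr rfl; intro b _
      apply Finset.sum_congr rfl; intro b' _
      rw [map_mul (starRingEnd ℂ), mul_sub, sub_eq_add_neg, AddChar.map_add_eq_mul, AddChar.map_neg_eq_conj]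
      ring
    simp_rw [e1]
    rw [← Finset.sum_nbij' (s := (Finset.univ : Finset (ZMod c))) (t := Finset.range c) (f := fun x : ZMod c => ∑ b ∈ S, ∑ b' ∈ S, (a b * (starRingEnd ℂ) (a b')) * ZMod.stdAddChar (x * (g b - g b'))) (ZMod.val) (fun r => (r : ZMod c))
      (by intro x _; simp [ZMod.val_lt]) (by simp) (by simp) (by intro r hr; simp at hr; simp [Nat.mod_eq_of_lt hr, ZMod.val_natCast]) (by intro x _; simp)]
    rw [Finset.sum_comm]
    have e2 : ∀ b ∈ S, ∑ x : ZMod c, ∑ b' ∈ S, (a b * (starRingEnd ℂ) (a b')) * ZMod.stdAddChar (x * (g b - g b')) = c := by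
      intro b hb
      rw [Finset.sum_comm]
      have e3 : ∀ b' ∈ S, ∑ x : ZMod c, (a b * (starRingEnd ℂ) (a b')) * ZMod.stdAddChar (x * (g b - g b')) = if b = b' then (c:ℂ) else 0 := by
        intro b' hb'
        rw [← Finset.mul_sum, AddChar.sum_mulShift _ (ZMod.isPrimitive_stdAddChar c)]
        by_cases h : b = b'
        · subst h
          simp only [sub_self, if_true, ZMod.card]
          rw [Complex.mul_conj', na]; simp
        · have : g b - g b' ≠ 0 := fun h2 => h (inj b hb b' hb' (sub_eq_zero.1 h2))
          simp [this, h]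
      rw [Finset.sum_congr rfl e3]
      simp [hb]
    rw [Finset.sum_congr rfl e2]
    simp; ring
  have main' : (∑ r ∈ Finset.range c, ‖kloos n (r : ℤ) c‖ ^ 2 : ℝ) = (c : ℝ) * S.card := by exact_mod_cast main
  rw [main', pow_two]
  have : S.card ≤ c := (Finset.card_filter_le _ _).trans (by simp)
  gcongr
end


section

def Bv (N : ℕ) (G : ℕ → ℂ) (M : ℝ) : Prop :=
  (∀ l ≤ N, ‖G l‖ ≤ M) ∧ ∑ l ∈ Finset.range N, ‖G (l+1) - G l‖ ≤ M

lemma Bv.nn {N : ℕ} {G : ℕ → ℂ} {M : ℝ} (h : Bv N G M) : 0 ≤ M := (norm_nonneg _).trans (h.1 0 (Nat.zero_le _))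

lemma Bv.mono {N : ℕ} {G : ℕ → ℂ} {M M' : ℝ} (h : Bv N G M) (hM : M ≤ M') : Bv N G M' :=
  ⟨fun l hl => (h.1 l hl).trans hM, h.2.trans hM⟩

lemma Bv.mul {N : ℕ} {G H : ℕ → ℂ} {M M' : ℝ} (h : Bv N G M) (h' : Bv N H M') : Bv N (fun l => G l * H l) (2 * M * M') := by
  have n1 := h.nn
  have n2 := h'.nn
  constructor
  · intro l hl
    rw [norm_mul]
    have := mul_le_mul (h.1 l hl) (h'.1 l hl) (norm_nonneg _) n1
    have : 0 ≤ M * M' := by positivity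
    linarith
  · have : ∀ l ∈ Finset.range N, ‖G (l+1) * H (l+1) - G l * H l‖ ≤ ‖G (l+1) - G l‖ * M' + M * ‖H (l+1) - H l‖ := by
      intro l hl
      have hl := Finset.mem_range.1 hl
      rw [show G (l+1) * H (l+1) - G l * H l = (G (l+1) - G l) * H (l+1) + G l * (H (l+1) - H l) by ring]
      refine (norm_add_le _ _).trans ?_
      rw [norm_mul, norm_mul]
      have a := h'.1 (l+1) (by omega)
      have b := h.1 l (by omega)
      gcongr
    refine (Finset.sum_le_sum this).trans ?_
    rw [Finset.sum_add_distrib, ← Finset.sum_mul, ← Finset.mul_sum]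
    have a := mul_le_mul_of_nonneg_right h.2 n2
    have b := mul_le_mul_of_nonneg_left h'.2 n1
    linarith

lemma Bv_mono_seq (N : ℕ) (v : ℕ → ℝ) (hv : Monotone v) (h0 : ∀ j, 0 ≤ v j) (M : ℝ) (hM : v N ≤ M) : Bv N (fun l => (v l : ℂ)) M := by
  constructor
  · intro l hl
    rw [Complex.norm_real, Real.norm_of_nonneg (h0 l)]
    exact (hv hl).trans hM
  · have : ∀ l ∈ Finset.range N, ‖((v (l+1) : ℂ)) - v l‖ = v (l+1) - v l := by
      intro l _
      rw [← Complex.ofReal_sub, Complex.norm_real, Real.norm_of_nonneg (sub_nonneg.2 (hv (Nat.le_succ l)))]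
    rw [Finset.sum_congr rfl this, Finset.sum_range_sub]
    have := h0 0
    linarith

lemma Bv_anti_seq (N : ℕ) (v : ℕ → ℝ) (hv : Antitone v) (h0 : ∀ j, 0 ≤ v j) (M : ℝ) (hM : v 0 ≤ M) : Bv N (fun l => (v l : ℂ)) M := by
  constructor
  · intro l hl
    rw [Complex.norm_real, Real.norm_of_nonneg (h0 l)]
    exact (hv (Nat.zero_le l)).trans hM
  · have : ∀ l ∈ Finset.range N, ‖((v (l+1) : ℂ)) - v l‖ = v l - v (l+1) := by
      intro l _
      rw [← Complex.ofReal_sub, Complex.norm_real, Real.norm_eq_abs, abs_sub_comm, abs_of_nonneg (sub_nonneg.2 (hv (Nat.le_succ l)))]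
    rw [Finset.sum_congr rfl this, Finset.sum_range_sub']
    have := h0 N
    linarith

lemma Bv_lip (N : ℕ) (G : ℕ → ℂ) (M d : ℝ) (hs : ∀ l ≤ N, ‖G l‖ ≤ M) (hd : ∀ l < N, ‖G (l+1) - G l‖ ≤ d) (h : N * d ≤ M) : Bv N G M := by
  refine ⟨hs, ?_⟩
  refine (Finset.sum_le_sum (fun l hl => hd l (Finset.mem_range.1 hl))).trans ?_
  simpa using h

lemma abel_id (G b : ℕ → ℂ) (N : ℕ) : ∑ l ∈ Finset.range N, G l * b l = G N * ∑ l ∈ Finset.range N, b l -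
    ∑ l ∈ Finset.range N, (G (l+1) - G l) * ∑ j ∈ Finset.range (l+1), b j := by
  induction N with
  | zero => simp
  | succ N ih =>
    rw [Finset.sum_range_succ, ih, Finset.sum_range_succ (fun l => (G (l+1) - G l) * ∑ j ∈ Finset.range (l+1), b j), Finset.sum_range_succ b]
    ring

lemma Bv_abel {N : ℕ} {G : ℕ → ℂ} {M : ℝ} (h : Bv N G M) (b : ℕ → ℂ) (B : ℝ) (hB : ∀ j ≤ N, ‖∑ l ∈ Finset.range j, b l‖ ≤ B) :
    ‖∑ l ∈ Finset.range N, G l * b l‖ ≤ 2 * M * B := by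
  have hB0 : 0 ≤ B := (norm_nonneg _).trans (hB 0 (Nat.zero_le _))
  rw [abel_id]
  refine (norm_sub_le _ _).trans ?_
  have h1 : ‖G N * ∑ l ∈ Finset.range N, b l‖ ≤ M * B := by
    rw [norm_mul]
    exact mul_le_mul (h.1 N le_rfl) (hB N le_rfl) (norm_nonneg _) h.nn
  have h2 : ‖∑ l ∈ Finset.range N, (G (l+1) - G l) * ∑ j ∈ Finset.range (l+1), b j‖ ≤ M * B := by
    refine (norm_sum_le _ _).trans ?_
    have : ∀ l ∈ Finset.range N, ‖(G (l+1) - G l) * ∑ j ∈ Finset.range (l+1), b j‖ ≤ ‖G (l+1) - G l‖ * B := by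
      intro l hl
      have hl := Finset.mem_range.1 hl
      rw [norm_mul]
      have := hB (l+1) (by omega)
      gcongr
    refine (Finset.sum_le_sum this).trans ?_
    rw [← Finset.sum_mul]
    exact mul_le_mul_of_nonneg_right h.2 hB0
  linarith

/-- admissible index sets -/
def Adm (N : ℕ) (s : Finset ℕ) : Prop := s = Finset.range N ∨ ∃ l < N, s = {l}

lemma Bv_J {N : ℕ} {G : ℕ → ℂ} {M : ℝ} (h : Bv N G M) (s : Finset ℕ) (hs : Adm N s) (e : ℕ) (y : ℝ) :
    ‖∑ l ∈ s, G l * besselJ (4*l+e) y‖ ≤ 2 * M * (1 + 4 * Real.log (1 + N)) := by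
  have hlog : 0 ≤ Real.log (1 + N) := Real.log_nonneg (by have : (0:ℝ) ≤ N := Nat.cast_nonneg N
                                                          linarith)
  rcases hs with rfl | ⟨l, hl, rfl⟩
  · apply Bv_abel h
    intro j hj
    refine (bessel_partial j e y).trans ?_
    have : Real.log (1 + j) ≤ Real.log (1 + N) := by
      apply Real.log_le_log (by positivity)
      have : (j:ℝ) ≤ N := by exact_mod_cast hj
      linarith
    linarith
  · rw [Finset.sum_singleton, norm_mul]
    have h1 := mul_le_mul (h.1 l hl.le) (norm_besselJ_le (4*l+e) y) (norm_nonneg _) h.nn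
    have := h.nn
    have : 0 ≤ M * Real.log (1+N) := by positivity
    nlinarith

/-- the weight function clipped -/
lemma rec_twice (y : ℝ) (l : ℕ) : besselJ (4*l+3) y = ((y:ℂ)^2 / 4) * ((1 / ((4*l+3) * (4*l+2))) * (besselJ (4*l+1) y + besselJ (4*l+3) y) + (1 / ((4*l+3) * (4*l+4))) * (besselJ (4*l+3) y + besselJ (4*l+5) y)) := by
  have h1 := besselJ_rec (4*l+1) y
  have h2 := besselJ_rec (4*l+2) y
  have h3 := besselJ_rec (4*l+3) y
  push_cast at h1 h2 h3
  have n1 : (4 * (l:ℂ) + 2) ≠ 0 := by norm_cast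
  have n2 : (4 * (l:ℂ) + 3) ≠ 0 := by norm_cast
  have n3 : (4 * (l:ℂ) + 4) ≠ 0 := by norm_cast
  have e1 : besselJ (4*l+2) y = (y:ℂ) * (besselJ (4*l+1) y + besselJ (4*l+3) y) / (2 * (4*l+2)) := by
    rw [eq_div_iff (by simpa using n1)]; linear_combination -h1
  have e3 : besselJ (4*l+4) y = (y:ℂ) * (besselJ (4*l+3) y + besselJ (4*l+5) y) / (2 * (4*l+4)) := by
    rw [eq_div_iff (by simpa using n3)]; linear_combination -h3
  have e2 : besselJ (4*l+3) y = (y:ℂ) * (besselJ (4*l+2) y + besselJ (4*l+4) y) / (2 * (4*l+3)) := by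
    rw [eq_div_iff (by simpa using n2)]; linear_combination -h2
  rw [e1, e3] at e2
  conv_lhs => rw [e2]
  field_simp
  ring
end


section

lemma w_lip (w : ℝ → ℝ) (hsm : ContDiff ℝ (⊤ : ℕ∞) w)
    (hbd : ∀ B : ℕ, ∃ M : ℝ, ∀ u, |iteratedDeriv B w u| ≤ M) :
    ∃ L : ℝ, 0 ≤ L ∧ (∀ u, |w u| ≤ L) ∧ ∀ u v, |w u - w v| ≤ L * |u - v| := by
  obtain ⟨M0, h0⟩ := hbd 0
  obtain ⟨M1, h1⟩ := hbd 1
  simp only [iteratedDeriv_zero, iteratedDeriv_one] at h0 h1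
  have n0 := (abs_nonneg _).trans (h0 0)
  refine ⟨max M0 M1, le_max_of_le_left n0, fun u => (h0 u).trans (le_max_left _ _), fun u v => ?_⟩
  have := Convex.norm_image_sub_le_of_norm_deriv_le (f := w) (s := Set.univ) (C := max M0 M1) (x := v) (y := u)
    (fun x _ => (hsm.differentiable (by simp)) x) (fun x _ => (h1 x).trans (le_max_right _ _)) convex_univ trivial trivial
  simpa using this

lemma N_le (K : ℝ) (hK : 2 ≤ K) : (⌈K⌉₊ : ℝ) ≤ 3/2 * K := by
  have := (Nat.ceil_lt_add_one (by linarith : 0 ≤ K)).le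
  linarith

lemma Bv_w (w : ℝ → ℝ) (L : ℝ) (hL : 0 ≤ L) (h0 : ∀ u, |w u| ≤ L) (h1 : ∀ u v, |w u - w v| ≤ L * |u - v|) (K : ℝ) (hK : 2 ≤ K) :
    Bv ⌈K⌉₊ (fun l => (w (((2*l+2:ℕ):ℝ) / K) : ℂ)) (3 * L) := by
  have hN := N_le K hK
  apply Bv_lip _ _ _ (L * (2 / K))
  · intro l _
    rw [Complex.norm_real]
    exact (h0 _).trans (by linarith)
  · intro l _
    rw [← Complex.ofReal_sub, Complex.norm_real]
    refine (h1 _ _).trans ?_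
    rw [← sub_div, show (((2 * (l + 1) + 2 : ℕ) : ℝ) - ((2 * l + 2 : ℕ) : ℝ)) = 2 by push_cast; ring, abs_of_nonneg (by positivity)]
  · calc (⌈K⌉₊ : ℝ) * (L * (2 / K)) ≤ (3/2*K) * (L * (2 / K)) := by gcongr
      _ = 3 * L := by field_simp

lemma Bv_lin (K : ℝ) (hK : 2 ≤ K) :
    Bv ⌈K⌉₊ (fun l => (((((2*l+2:ℕ):ℝ) - 1) / K : ℝ) : ℂ)) 4 := by
  have hN := N_le K hK
  apply Bv_mono_seq _ (fun l => (((2*l+2:ℕ):ℝ) - 1) / K)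
  · intro a b hab
    have : (a:ℝ) ≤ b := by exact_mod_cast hab
    simp only
    gcongr
  · intro j
    push_cast
    apply div_nonneg _ (by linarith)
    have : (0:ℝ) ≤ j := Nat.cast_nonneg j
    linarith
  · rw [div_le_iff₀ (by linarith)]; push_cast; linarith

lemma Bv_A (K ε x : ℝ) (hK : 2 ≤ K) (hε : 0 < ε) (hε1 : ε ≤ 1) (hx : 12 * K ^ ((2:ℝ) - ε) ≤ x) :
    Bv ⌈K⌉₊ (fun l => (-1)^l * besselJ (2*l+1) x) (20 * (K ^ ε * x ^ (-(1/2):ℝ))) := by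
  have hN := N_le K hK
  have hK0 : 0 < K := by linarith
  have hKx : 12 * K ≤ x := by
    refine le_trans ?_ hx
    have : K ^ (1:ℝ) ≤ K ^ ((2:ℝ) - ε) := Real.rpow_le_rpow_of_exponent_le (by linarith) (by linarith)
    rw [Real.rpow_one] at this
    linarith
  have hx0 : 0 < x := by linarith
  have hKe : 1 ≤ K ^ ε := Real.one_le_rpow (by linarith) hε.le
  have hxp : 0 < x ^ (-(1/2):ℝ) := by positivity
  have hx2 : 12 * K^2 ≤ x * K ^ ε := by
    calc 12 * K^2 = 12 * K ^ ((2:ℝ) - ε) * K ^ ε := by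
          rw [mul_assoc, ← Real.rpow_add hK0]; simp
      _ ≤ _ := by gcongr
  apply Bv_lip _ _ _ (60 * ⌈K⌉₊ / x * x ^ (-(1/2):ℝ))
  · intro l hl
    have hl : (l:ℝ) ≤ ⌈K⌉₊ := by exact_mod_cast hl
    rw [norm_mul, norm_pow, norm_neg, norm_one, one_pow, one_mul]
    refine (bessel_bound x (by linarith) _ (by push_cast; linarith)).trans ?_
    nlinarith
  · intro l hl
    have hl : (l:ℝ) + 1 ≤ ⌈K⌉₊ := by exact_mod_cast hl
    have hr := besselJ_rec (2*l+1) x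
    have hxc : (x:ℂ) ≠ 0 := by exact_mod_cast hx0.ne'
    have e : (-1)^(l+1) * besselJ (2*(l+1)+1) x - (-1)^l * besselJ (2*l+1) x = (-1)^(l+1) * (((4*(l+1) / x : ℝ) : ℂ) * besselJ (2*l+2) x) := by
      push_cast at hr ⊢
      rw [show 2*(l+1)+1 = 2*l+1+2 by ring, div_mul_eq_mul_div, show 4 * ((l:ℂ)+1) * besselJ (2*l+2) x = 2 * (2 * l + 1 + 1) * besselJ (2*l+1+1) x by ring_nf, ← hr]
      field_simp
      ring
    rw [e, norm_mul, norm_pow, norm_neg, norm_one, one_pow, one_mul, norm_mul, Complex.norm_real, Real.norm_of_nonneg (by positivity)]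
    have := bessel_bound x (by linarith) (2*l+2) (by push_cast; linarith)
    calc _ ≤ 4 * ((l:ℝ)+1) / x * (15 * x ^ (-(1/2):ℝ)) := by gcongr
      _ ≤ 4 * (⌈K⌉₊:ℝ) / x * (15 * x ^ (-(1/2):ℝ)) := by gcongr
      _ = _ := by ring
  · have : (⌈K⌉₊:ℝ) * (60 * ⌈K⌉₊ / x) ≤ 20 * K ^ ε := by
      rw [mul_div_assoc', div_le_iff₀ hx0]
      have : (⌈K⌉₊:ℝ) * ⌈K⌉₊ ≤ (3/2*K)*(3/2*K) := by gcongr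
      nlinarith
    calc _ = (⌈K⌉₊:ℝ) * (60 * ⌈K⌉₊ / x) * x ^ (-(1/2):ℝ) := by ring
      _ ≤ 20 * K ^ ε * x ^ (-(1/2):ℝ) := by gcongr
      _ = _ := by ring

lemma Bv_V1 (K m : ℝ) (hK : 2 ≤ K) (hm : 0 < m) :
    Bv ⌈K⌉₊ (fun l => V 1 ((2*l+2:ℕ):ℝ) m) (25 * min 1 ((K/m)^2)) := by
  have hN := N_le K hK
  obtain ⟨v, h1, h2, h3, h4, h5⟩ := V1_nn m hm
  have : (fun l : ℕ => V 1 ((2*l+2:ℕ):ℝ) m) = fun l => ((fun l => v (2*l+2)) l : ℂ) := by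
    funext l; exact h1 _ (by omega)
  rw [this]
  apply Bv_mono_seq _ (fun l => v (2*l+2)) (fun a b hab => h3 (by omega)) (fun j => h2 _)
  rw [mul_min_of_nonneg _ _ (by norm_num)]
  apply le_min
  · exact (h4 _).trans (by norm_num)
  · refine (h5 _).trans ?_
    push_cast
    calc ((2 * (⌈K⌉₊:ℝ) + 2 + 1) / m)^2 ≤ (5 * K / m)^2 := by gcongr; linarith
      _ = _ := by ring

lemma Bv_V2 (K ξ : ℝ) (hK : 2 ≤ K) (hξ : 0 < ξ) :
    Bv ⌈K⌉₊ (fun l => V 2 ((2*l+2:ℕ):ℝ) ξ) (4000000000 * (K^2/ξ)^3) := by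
  have hN := N_le K hK
  have hK0 : 0 < K := by linarith
  apply Bv_lip _ _ _ (2 * (1270080 * (4*K)^5 / ξ^3))
  · intro l hl
    have hl : (l:ℝ) ≤ ⌈K⌉₊ := by exact_mod_cast hl
    refine (V2_bound (2*l+2) (by omega) ξ hξ).trans ?_
    push_cast
    calc 864 * (2 * (l:ℝ) + 2)^6 / ξ^3 ≤ 864 * (4 * K)^6 / ξ^3 := by gcongr; linarith
      _ = 3538944 * (K^2/ξ)^3 := by rw [div_pow]; ring
      _ ≤ _ := by gcongr; norm_num
  · intro l hl
    have hl : (l:ℝ) + 1 ≤ ⌈K⌉₊ := by exact_mod_cast hl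
    have d1 := V2_diff (2*l+2) (by omega) ξ hξ
    have d2 := V2_diff (2*l+2+1) (by omega) ξ hξ
    have b1 : 1270080 * ((2*l+2:ℕ):ℝ)^5 / ξ^3 ≤ 1270080 * (4*K)^5 / ξ^3 := by gcongr; push_cast; linarith
    have b2 : 1270080 * ((2*l+2+1:ℕ):ℝ)^5 / ξ^3 ≤ 1270080 * (4*K)^5 / ξ^3 := by gcongr; push_cast; linarith
    have e : V 2 ((2*(l+1)+2:ℕ):ℝ) ξ - V 2 ((2*l+2:ℕ):ℝ) ξ = (V 2 ((2*l+2+1+1:ℕ):ℝ) ξ - V 2 ((2*l+2+1:ℕ):ℝ) ξ) + (V 2 ((2*l+2+1:ℕ):ℝ) ξ - V 2 ((2*l+2:ℕ):ℝ) ξ) := by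
      rw [show 2*(l+1)+2 = 2*l+2+1+1 by ring]; ring
    rw [e]
    refine (norm_add_le _ _).trans ?_
    linarith
  · calc (⌈K⌉₊:ℝ) * (2 * (1270080 * (4*K)^5 / ξ^3)) ≤ (3/2*K) * (2 * (1270080 * (4*K)^5 / ξ^3)) := by gcongr
      _ = 3901685760 * (K^2/ξ)^3 := by rw [div_pow]; ring
      _ ≤ _ := by gcongr; norm_num

noncomputable def qq (i : ℕ) (K : ℝ) (l : ℕ) : ℝ :=
  if i = 0 then 1 else if i = 1 then K^2 / ((2 * max ((2*l+2:ℕ):ℝ) K - 1) * (2 * max ((2*l+2:ℕ):ℝ) K - 2)) else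
    K^2 / ((2 * max ((2*l+2:ℕ):ℝ) K - 1) * (2 * max ((2*l+2:ℕ):ℝ) K))

lemma Bv_qq (i : ℕ) (K : ℝ) (hK : 2 ≤ K) : Bv ⌈K⌉₊ (fun l => (qq i K l : ℂ)) 1 := by
  have hm : ∀ l : ℕ, K ≤ max ((2*l+2:ℕ):ℝ) K := fun l => le_max_right _ _
  have mono : ∀ a b : ℕ, a ≤ b → max ((2*a+2:ℕ):ℝ) K ≤ max ((2*b+2:ℕ):ℝ) K := by
    intro a b hab
    gcongr
  apply Bv_anti_seq
  · intro a b hab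
    have h1 := hm a
    have h2 := hm b
    have h3 := mono a b hab
    unfold qq
    split_ifs
    · exact le_rfl
    · apply div_le_div_of_nonneg_left (by positivity) (mul_pos (by linarith) (by linarith))
      apply mul_le_mul <;> linarith
    · apply div_le_div_of_nonneg_left (by positivity) (mul_pos (by linarith) (by linarith))
      apply mul_le_mul <;> linarith
  · intro l
    have h1 := hm l
    unfold qq
    split_ifs
    · norm_num
    · exact div_nonneg (by positivity) (mul_nonneg (by linarith) (by linarith))
    · exact div_nonneg (by positivity) (mul_nonneg (by linarith) (by linarith))
  · have h1 := hm 0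
    unfold qq
    split_ifs
    · norm_num
    · rw [div_le_one (mul_pos (by linarith) (by linarith))]
      nlinarith
    · rw [div_le_one (mul_pos (by linarith) (by linarith))]
      nlinarith
end


section

noncomputable def yy (α β n m c₁ : ℕ) : ℝ := 4 * Real.pi * Real.sqrt ((n : ℝ) * m * α * β ^ 2) / c₁
noncomputable def xx (r₁ n c₂ : ℕ) : ℝ := 4 * Real.pi * n * r₁ / c₂
noncomputable def xi (α β γ r₂ n : ℕ) : ℝ := (n : ℝ) * r₂ ^ 2 * α ^ 3 * β ^ 2 * γ ^ 2

noncomputable def GG (w : ℝ → ℝ) (K x m ξ : ℝ) (i l : ℕ) : ℂ :=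
  ((((w (((2*l+2:ℕ):ℝ) / K) : ℂ) * (((((2*l+2:ℕ):ℝ) - 1) / K : ℝ) : ℂ)) * ((-1)^l * besselJ (2*l+1) x)) *
    (V 1 ((2*l+2:ℕ):ℝ) m) * (V 2 ((2*l+2:ℕ):ℝ) ξ)) * (qq i K l : ℂ)

lemma I_pow_even (l : ℕ) : Complex.I ^ (2*l+2) = -(-1)^l := by
  rw [pow_add, pow_mul, Complex.I_sq]; ring

lemma T_eq (w : ℝ → ℝ) (K : ℝ) (α β γ r₁ r₂ l n m c₁ c₂ : ℕ) :
    T w K α β γ r₁ r₂ (2*l+2) n m c₁ c₂ =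
     (-(1 / Real.sqrt ((n:ℝ) * m) : ℝ) * (kloos ((n : ℤ) ^ 2) ((r₁ : ℤ) ^ 2) c₂ / (c₂ : ℂ)) *
      (kloos ((n : ℤ) * α * β ^ 2) (m : ℤ) c₁ / (c₁ : ℂ))) * (GG w K (xx r₁ n c₂) m (xi α β γ r₂ n) 0 l * besselJ (4*l+3) (yy α β n m c₁)) := by
  unfold T GG qq xx yy xi
  rw [I_pow_even, show 2*l+2-1 = 2*l+1 by omega, show 2*(2*l+2)-1 = 4*l+3 by omega]
  simp only [if_true]
  push_cast
  ring

lemma GG_Bv (w : ℝ → ℝ) (L : ℝ) (hL : 0 ≤ L) (h0 : ∀ u, |w u| ≤ L) (h1 : ∀ u v, |w u - w v| ≤ L * |u - v|)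
   (K ε x m ξ : ℝ) (hK : 2 ≤ K) (hε : 0 < ε) (hε1 : ε ≤ 1) (hx : 12 * K ^ ((2:ℝ) - ε) ≤ x) (hm : 0 < m) (hξ : 0 < ξ) (i : ℕ) :
   Bv ⌈K⌉₊ (GG w K x m ξ i) ((768000000000000 * L) * (K ^ ε * x ^ (-(1/2):ℝ) * min 1 ((K/m)^2) * (K^2/ξ)^3)) := by
  have b1 := Bv_w w L hL h0 h1 K hK
  have b2 := Bv_lin K hK
  have b3 := Bv_A K ε x hK hε hε1 hx
  have b4 := Bv_V1 K m hK hm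
  have b5 := Bv_V2 K ξ hK hξ
  have b6 := Bv_qq i K hK
  have := ((((b1.mul b2).mul b3).mul b4).mul b5).mul b6
  have nn := this.nn
  refine this.mono (le_of_eq ?_)
  ring

lemma GG_rel (w : ℝ → ℝ) (hsupp : Function.support w ⊆ Set.Ioo 1 2) (K x m ξ y : ℝ) (hK : 2 ≤ K) (l : ℕ) :
   GG w K x m ξ 0 l * besselJ (4*l+3) y = (((y / K)^2 / 4 : ℝ) : ℂ) * (GG w K x m ξ 1 l * besselJ (4*l+1) y + GG w K x m ξ 1 l * besselJ (4*l+3) y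
     + GG w K x m ξ 2 l * besselJ (4*l+3) y + GG w K x m ξ 2 l * besselJ (4*l+5) y) := by
  by_cases hw : w (((2*l+2:ℕ):ℝ) / K) = 0
  · simp only [GG, hw, Complex.ofReal_zero, zero_mul, add_zero, mul_zero]
  · have h1 := (hsupp hw).1
    rw [lt_div_iff₀ (by linarith), one_mul] at h1
    have hKc : (K:ℂ) ≠ 0 := by exact_mod_cast (by linarith : K ≠ 0)
    have n1 : (4 * (l:ℂ) + 2) ≠ 0 := by norm_cast
    have n2 : (4 * (l:ℂ) + 3) ≠ 0 := by norm_cast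
    have n3 : (4 * (l:ℂ) + 4) ≠ 0 := by norm_cast
    have q1 : (qq 1 K l : ℂ) = K^2 * (1 / ((4*l+3)*(4*l+2))) := by
      unfold qq
      rw [max_eq_left h1.le]
      simp only [one_ne_zero, if_false, if_true]
      push_cast
      rw [show (2 * (2 * (l:ℂ) + 2) - 1) = 4*l+3 by ring, show (2 * (2 * (l:ℂ) + 2) - 2) = 4*l+2 by ring]
      ring
    have q2 : (qq 2 K l : ℂ) = K^2 * (1 / ((4*l+3)*(4*l+4))) := by
      unfold qq
      rw [max_eq_left h1.le]
      simp only [show ¬ ((2:ℕ) = 0) by norm_num, show ¬ ((2:ℕ) = 1) by norm_num, if_false]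
      push_cast
      rw [show (2 * (2 * (l:ℂ) + 2) - 1) = 4*l+3 by ring, show (2 * (2 * (l:ℂ) + 2)) = 4*l+4 by ring]
      ring
    have q0 : (qq 0 K l : ℂ) = 1 := by simp [qq]
    unfold GG
    rw [q0, q1, q2]
    conv_lhs => rw [rec_twice]
    have : (((y / K)^2 / 4 : ℝ) : ℂ) * K^2 = (y:ℂ)^2/4 := by push_cast; field_simp
    rw [← this]
    ring

lemma k_sum (w : ℝ → ℝ) (hsm : ContDiff ℝ (⊤ : ℕ∞) w) (hsupp : Function.support w ⊆ Set.Ioo 1 2)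
    (hbd : ∀ B : ℕ, ∃ M : ℝ, ∀ u, |iteratedDeriv B w u| ≤ M) :
    ∃ C : ℝ, 0 ≤ C ∧ ∀ K ε : ℝ, 2 ≤ K → 0 < ε → ε ≤ 1 → ∀ α β γ r₁ r₂ n m c₁ c₂ : ℕ,
      0 < α → 0 < β → 0 < γ → 0 < r₁ → 0 < r₂ → 0 < n → 0 < m → 0 < c₁ → 0 < c₂ → cond1 K ε r₁ n c₂ →
      ∀ s, Adm ⌈K⌉₊ s →
      ‖∑ l ∈ s, T w K α β γ r₁ r₂ (2*l+2) n m c₁ c₂‖ ≤ C * (1 + 4 * Real.log (1 + ⌈K⌉₊)) *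
       ((1 / Real.sqrt ((n:ℝ) * m)) * (‖kloos ((n : ℤ) * α * β ^ 2) (m : ℤ) c₁‖ / c₁) *
        (K ^ ε * (xx r₁ n c₂) ^ (-(1/2):ℝ) * min 1 ((K/m)^2) * (K^2/(xi α β γ r₂ n))^3 * min 1 ((yy α β n m c₁ / K)^2))) := by
  obtain ⟨L, hL, h0, h1⟩ := w_lip w hsm hbd
  refine ⟨2 * (768000000000000 * L), by positivity, ?_⟩
  intro K ε hK hε hε1 α β γ r₁ r₂ n m c₁ c₂ hα hβ hγ hr₁ hr₂ hn hm hc₁ hc₂ hc s hs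
  have hx : 12 * K ^ ((2:ℝ) - ε) ≤ xx r₁ n c₂ := by
    unfold cond1 at hc
    unfold xx
    have := Real.pi_gt_three
    have p : 0 < K ^ ((2:ℝ) - ε) := by positivity
    calc 12 * K ^ ((2:ℝ) - ε) ≤ (4 * Real.pi) * ((n:ℝ) * r₁ / c₂) := by
          apply mul_le_mul <;> linarith
      _ = _ := by ring
  have hξ : 0 < xi α β γ r₂ n := by unfold xi; positivity
  have hm' : (0:ℝ) < m := by exact_mod_cast hm
  have B := fun i => GG_Bv w L hL h0 h1 K ε (xx r₁ n c₂) m (xi α β γ r₂ n) hK hε hε1 hx hm' hξ i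
  set y := yy α β n m c₁ with hy
  set M := (768000000000000 * L) * (K ^ ε * (xx r₁ n c₂) ^ (-(1/2):ℝ) * min 1 ((K/m)^2) * (K^2/(xi α β γ r₂ n))^3) with hM
  set Lg := (1 + 4 * Real.log (1 + ⌈K⌉₊)) with hLg
  have J := fun i e => Bv_J (B i) s hs e y
  have key : ‖∑ l ∈ s, GG w K (xx r₁ n c₂) m (xi α β γ r₂ n) 0 l * besselJ (4*l+3) y‖ ≤ 2 * M * Lg * min 1 ((y/K)^2) := by
    have nn : 0 ≤ 2 * M * Lg := (norm_nonneg _).trans (J 0 0)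
    rw [mul_min_of_nonneg _ _ nn]
    apply le_min
    · rw [mul_one]; exact J 0 3
    · have e : ∑ l ∈ s, GG w K (xx r₁ n c₂) m (xi α β γ r₂ n) 0 l * besselJ (4*l+3) y = (((y / K)^2 / 4 : ℝ) : ℂ) *
        (∑ l ∈ s, GG w K (xx r₁ n c₂) m (xi α β γ r₂ n) 1 l * besselJ (4*l+1) y + ∑ l ∈ s, GG w K (xx r₁ n c₂) m (xi α β γ r₂ n) 1 l * besselJ (4*l+3) y
         + ∑ l ∈ s, GG w K (xx r₁ n c₂) m (xi α β γ r₂ n) 2 l * besselJ (4*l+3) y + ∑ l ∈ s, GG w K (xx r₁ n c₂) m (xi α β γ r₂ n) 2 l * besselJ (4*l+5) y) := by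
        rw [← Finset.sum_add_distrib, ← Finset.sum_add_distrib, ← Finset.sum_add_distrib, Finset.mul_sum]
        apply Finset.sum_congr rfl
        intro l _
        exact GG_rel w hsupp K _ _ _ y hK l
      rw [e, norm_mul, Complex.norm_real, Real.norm_of_nonneg (by positivity)]
      have t1 := J 1 1
      have t2 := J 1 3
      have t3 := J 2 3
      have t4 := J 2 5
      calc _ ≤ (y / K)^2 / 4 * (2 * M * Lg + 2 * M * Lg + 2 * M * Lg + 2 * M * Lg) := by
            apply mul_le_mul_of_nonneg_left _ (by positivity)
            refine (norm_add_le _ _).trans (add_le_add ((norm_add_le _ _).trans (add_le_add ((norm_add_le _ _).trans (add_le_add t1 t2)) t3)) t4)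
        _ = _ := by ring
  simp_rw [T_eq]
  rw [← Finset.mul_sum, norm_mul, norm_mul, norm_mul, norm_neg, Complex.norm_real, Real.norm_of_nonneg (by positivity), norm_div, norm_div, Complex.norm_natCast, Complex.norm_natCast]
  have k1 : ‖kloos ((n : ℤ) ^ 2) ((r₁ : ℤ) ^ 2) c₂‖ / c₂ ≤ 1 := by
    rw [div_le_one (by exact_mod_cast hc₂)]; exact norm_kloos_le _ _ _
  calc _ ≤ (1 / Real.sqrt ((n:ℝ) * m)) * 1 * (‖kloos ((n : ℤ) * α * β ^ 2) (m : ℤ) c₁‖ / c₁) * (2 * M * Lg * min 1 ((y/K)^2)) := by gcongr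
    _ = _ := by rw [hM]; ring
end


section

lemma min_le_rpow' (t a : ℝ) (ht : 0 < t) (ha : 0 ≤ a) (ha1 : a ≤ 1) : min 1 t ≤ t ^ a := by
  rcases le_total t 1 with h | h
  · refine (min_le_right _ _).trans ?_
    calc t = t ^ (1:ℝ) := (Real.rpow_one t).symm
      _ ≤ t ^ a := Real.rpow_le_rpow_of_exponent_ge ht h ha1
  · exact (min_le_left _ _).trans (Real.one_le_rpow h ha)

lemma mu_le (t a : ℝ) (ht : 0 < t) (ha : 0 ≤ a) (ha1 : a ≤ 2) : min 1 (t^2) ≤ t ^ a := by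
  rcases le_total t 1 with h | h
  · refine (min_le_right _ _).trans ?_
    calc t^2 = t ^ (2:ℝ) := by norm_cast
      _ ≤ t ^ a := Real.rpow_le_rpow_of_exponent_ge ht h ha1
  · exact (min_le_left _ _).trans (Real.one_le_rpow h ha)

noncomputable def ff (K : ℝ) (m : ℕ) : ℝ := (m:ℝ)^(-(1/8):ℝ) * min 1 ((K/m)^2)

lemma ff_nn (K : ℝ) (m : ℕ) : 0 ≤ ff K m := by unfold ff; positivity

lemma ff_le_one (K : ℝ) (m : ℕ) : ff K m ≤ 1 := by
  unfold ff
  rcases Nat.eq_zero_or_pos m with h | h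
  · subst h; simp
  · have h1 : (1:ℝ) ≤ m := by exact_mod_cast h
    have := Real.rpow_le_one_of_one_le_of_nonpos h1 (by norm_num : (-(1/8):ℝ) ≤ 0)
    calc _ ≤ (1:ℝ) * 1 := by
          gcongr
          exact min_le_left _ _
      _ = 1 := one_mul _

lemma ff_le (K : ℝ) (hK : 2 ≤ K) (m : ℕ) (hm : 1 ≤ m) : ff K m ≤ K ^ (177/200:ℝ) * (m:ℝ)^(-(101/100):ℝ) := by
  unfold ff
  have h1 : (0:ℝ) < m := by exact_mod_cast hm
  have := mu_le (K/m) (177/200) (by positivity) (by norm_num) (by norm_num)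
  calc _ ≤ (m:ℝ)^(-(1/8):ℝ) * (K/m)^(177/200:ℝ) := by gcongr
    _ = K ^ (177/200:ℝ) * ((m:ℝ)^(-(1/8):ℝ) * (m:ℝ)^(-(177/200):ℝ)) := by
        rw [Real.div_rpow (by linarith) h1.le, Real.rpow_neg h1.le (177/200)]; ring
    _ = _ := by rw [← Real.rpow_add h1]; norm_num

noncomputable def II (K R : ℝ) (Z : ℤ) (m c : ℕ) : ℝ :=
  (m:ℝ)^(-(1/2):ℝ) * (‖kloos Z m c‖/c) * min 1 ((K/m)^2) * min 1 (R*m/c^2)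

lemma rpow_le_one_add (R a : ℝ) (hR : 0 ≤ R) (ha : 0 ≤ a) (ha1 : a ≤ 1) : R ^ a ≤ 1 + R := by
  rcases le_total R 1 with h | h
  · have := Real.rpow_le_one hR h ha
    linarith
  · have := Real.rpow_le_rpow_of_exponent_le h ha1
    rw [Real.rpow_one] at this; linarith

lemma II_le (K R : ℝ) (hK : 2 ≤ K) (hR : 0 < R) (Z : ℤ) (m c : ℕ) (hm : 1 ≤ m) (hc : 1 ≤ c) :
    II K R Z m c ≤ (1 + R) * (K ^ (177/200:ℝ) * ((m:ℝ)^(-(101/100):ℝ) * (c:ℝ)^(-(101/100):ℝ)) +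
      if (c:ℝ) ≤ K then (c:ℝ)^(-(9/4):ℝ) * (ff K m * ‖kloos Z m c‖^2) else 0) := by
  have hm0 : (0:ℝ) < m := by exact_mod_cast hm
  have hc0 : (0:ℝ) < c := by exact_mod_cast hc
  have hc1 : (1:ℝ) ≤ c := by exact_mod_cast hc
  have hK0 : 0 < K := by linarith
  have hff := ff_le K hK m hm
  have hfn := ff_nn K m
  split_ifs with hcK
  · set S := ‖kloos Z m c‖ with hS
    have hS0 : 0 ≤ S := norm_nonneg _
    have h1 := min_le_rpow' (R*m/c^2) (3/8) (by positivity) (by norm_num) (by norm_num)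
    have e1 : (R*m/c^2)^(3/8:ℝ) = R^(3/8:ℝ) * (m:ℝ)^(3/8:ℝ) * (c:ℝ)^(-(3/4):ℝ) := by
      rw [Real.div_rpow (by positivity) (by positivity), Real.mul_rpow hR.le hm0.le, ← Real.rpow_natCast (c:ℝ) 2, ← Real.rpow_mul hc0.le, div_eq_mul_inv, ← Real.rpow_neg hc0.le]
      norm_num
    have hRR := rpow_le_one_add R (3/8) hR.le (by norm_num) (by norm_num)
    have e2 : II K R Z m c ≤ R^(3/8:ℝ) * (ff K m * ((c:ℝ)^(-(7/4):ℝ) * S)) := by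
      calc II K R Z m c ≤ (m:ℝ)^(-(1/2):ℝ) * (S/c) * min 1 ((K/m)^2) * (R^(3/8:ℝ) * (m:ℝ)^(3/8:ℝ) * (c:ℝ)^(-(3/4):ℝ)) := by
            unfold II; rw [← e1]; gcongr
        _ = R^(3/8:ℝ) * ((((m:ℝ)^(-(1/2):ℝ) * (m:ℝ)^(3/8:ℝ)) * min 1 ((K/m)^2)) * (((c:ℝ)^(-(3/4):ℝ) * (c:ℝ)^(-1:ℝ)) * S)) := by
            rw [Real.rpow_neg_one]; ring
        _ = _ := by
            rw [← Real.rpow_add hm0, ← Real.rpow_add hc0]; unfold ff; norm_num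
    have amgm : (c:ℝ)^(-(7/4):ℝ) * S ≤ (c:ℝ)^(-(101/100):ℝ) + (c:ℝ)^(-(9/4):ℝ) * S^2 := by
      have a1 : (c:ℝ)^(-(5/4):ℝ) ≤ (c:ℝ)^(-(101/100):ℝ) := Real.rpow_le_rpow_of_exponent_le hc1 (by norm_num)
      have a2 : (c:ℝ)^(-(5/4):ℝ) = ((c:ℝ)^(-(5/8):ℝ))^2 := by
        rw [← Real.rpow_natCast, ← Real.rpow_mul hc0.le]; norm_num
      have a3 : (c:ℝ)^(-(9/4):ℝ) = ((c:ℝ)^(-(9/8):ℝ))^2 := by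
        rw [← Real.rpow_natCast, ← Real.rpow_mul hc0.le]; norm_num
      have a4 : (c:ℝ)^(-(7/4):ℝ) = (c:ℝ)^(-(5/8):ℝ) * (c:ℝ)^(-(9/8):ℝ) := by
        rw [← Real.rpow_add hc0]; norm_num
      rw [a2] at a1
      rw [a3, a4]
      nlinarith [sq_nonneg ((c:ℝ)^(-(5/8):ℝ) - (c:ℝ)^(-(9/8):ℝ) * S), sq_nonneg ((c:ℝ)^(-(5/8):ℝ)), sq_nonneg ((c:ℝ)^(-(9/8):ℝ) * S)]
    refine e2.trans ?_
    have p1 : 0 < (c:ℝ)^(-(7/4):ℝ) := by positivity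
    calc _ ≤ (1 + R) * (ff K m * ((c:ℝ)^(-(101/100):ℝ) + (c:ℝ)^(-(9/4):ℝ) * S^2)) := by gcongr
      _ = (1 + R) * (ff K m * (c:ℝ)^(-(101/100):ℝ) + (c:ℝ)^(-(9/4):ℝ) * (ff K m * S^2)) := by ring
      _ ≤ (1 + R) * ((K ^ (177/200:ℝ) * (m:ℝ)^(-(101/100):ℝ)) * (c:ℝ)^(-(101/100):ℝ) + (c:ℝ)^(-(9/4):ℝ) * (ff K m * S^2)) := by gcongr
      _ = _ := by ring
  · push Not at hcK
    have hk : ‖kloos Z m c‖/c ≤ 1 := by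
      rw [div_le_one hc0]; exact norm_kloos_le _ _ _
    have hmu := mu_le (K/m) (151/100) (by positivity) (by norm_num) (by norm_num)
    rw [add_zero]
    have e3 : (c:ℝ)^(-2:ℝ) ≤ K^(-(99/100):ℝ) * (c:ℝ)^(-(101/100):ℝ) := by
      rw [show (-2:ℝ) = -(99/100) + -(101/100) by norm_num, Real.rpow_add hc0]
      exact mul_le_mul_of_nonneg_right (Real.rpow_le_rpow_of_nonpos hK0 hcK.le (by norm_num)) (by positivity)
    have e4 : K^(52/100:ℝ) ≤ K^(177/200:ℝ) := Real.rpow_le_rpow_of_exponent_le (by linarith) (by norm_num)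
    calc II K R Z m c ≤ (m:ℝ)^(-(1/2):ℝ) * 1 * (K/m)^(151/100:ℝ) * (R*m/c^2) := by
          unfold II; gcongr; exact min_le_right _ _
      _ = R * (K^(151/100:ℝ) * (((m:ℝ)^(-(1/2):ℝ) * (m:ℝ)^(-(151/100):ℝ) * (m:ℝ)^(1:ℝ)) * (c:ℝ)^(-2:ℝ))) := by
          rw [Real.div_rpow hK0.le hm0.le, Real.rpow_neg hm0.le (151/100), Real.rpow_one, Real.rpow_neg hc0.le]
          norm_cast
          field_simp
      _ = R * (K^(151/100:ℝ) * ((m:ℝ)^(-(101/100):ℝ) * (c:ℝ)^(-2:ℝ))) := by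
          rw [← Real.rpow_add hm0, ← Real.rpow_add hm0]; norm_num
      _ ≤ R * (K^(151/100:ℝ) * ((m:ℝ)^(-(101/100):ℝ) * (K^(-(99/100):ℝ) * (c:ℝ)^(-(101/100):ℝ)))) := by gcongr
      _ = R * ((K^(151/100:ℝ) * K^(-(99/100):ℝ)) * ((m:ℝ)^(-(101/100):ℝ) * (c:ℝ)^(-(101/100):ℝ))) := by ring
      _ = R * (K^(52/100:ℝ) * ((m:ℝ)^(-(101/100):ℝ) * (c:ℝ)^(-(101/100):ℝ))) := by
          rw [← Real.rpow_add hK0]; norm_num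
      _ ≤ (1 + R) * (K^(177/200:ℝ) * ((m:ℝ)^(-(101/100):ℝ) * (c:ℝ)^(-(101/100):ℝ))) := by
          gcongr; linarith
end


section
open ENNReal

noncomputable def az (p : ℝ) (n : ℕ) : ℝ≥0∞ := ENNReal.ofReal ((n:ℝ)^(-p))
noncomputable def zs (p : ℝ) : ℝ≥0∞ := ∑' n : ℕ, az p n

lemma zs_ne_top (p : ℝ) (hp : 1 < p) : zs p ≠ ⊤ := by
  unfold zs az
  rw [← ENNReal.ofReal_tsum_of_nonneg (fun n => by positivity) (Real.summable_nat_rpow.2 (by linarith))]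
  exact ENNReal.ofReal_ne_top

lemma block (F : ℕ → ℝ≥0∞) (c : ℕ) (hc : 1 ≤ c) : ∑' m, F m = ∑' j : ℕ, ∑ r ∈ Finset.range c, F (c * j + r) := by
  have : NeZero c := ⟨by omega⟩
  rw [← (Nat.divModEquiv c).symm.tsum_eq F]
  refine (ENNReal.tsum_prod (f := fun j (r : Fin c) => F ((Nat.divModEquiv c).symm (j, r)))).trans ?_
  congr 1
  funext j
  rw [tsum_fintype, Finset.sum_range]
  apply Finset.sum_congr rfl
  intro r _
  congr 1
  simp [Nat.divModEquiv, mul_comm]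

lemma ff_block (K : ℝ) (hK : 2 ≤ K) (c j r : ℕ) (hc : 1 ≤ c) :
    ff K (c * j + r) ≤ (if j = 0 then 1 else 0) + K ^ (177/200:ℝ) * (c:ℝ)^(-(101/100):ℝ) * (j:ℝ)^(-(101/100):ℝ) := by
  split_ifs with h
  · subst h
    refine (ff_le_one _ _).trans ?_
    rw [Nat.cast_zero, Real.zero_rpow (by norm_num)]; simp
  · have hj : 1 ≤ j := Nat.one_le_iff_ne_zero.2 h
    have hcj : 1 ≤ c * j := Nat.mul_pos hc hj
    have hcj' : (0:ℝ) < ((c * j : ℕ) : ℝ) := by exact_mod_cast hcj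
    rw [zero_add]
    refine (ff_le K hK _ (by omega)).trans ?_
    rw [mul_assoc, ← Real.mul_rpow (by positivity) (by positivity), ← Nat.cast_mul]
    apply mul_le_mul_of_nonneg_left _ (by positivity)
    apply Real.rpow_le_rpow_of_nonpos hcj' _ (by norm_num)
    exact_mod_cast Nat.le_add_right _ _

lemma block_sum (K : ℝ) (hK : 2 ≤ K) (Z : ℤ) (c : ℕ) (hc : 1 ≤ c) :
    ∑' m : ℕ, ENNReal.ofReal (ff K m * ‖kloos Z m c‖^2) ≤ ENNReal.ofReal ((c:ℝ)^2) * (1 + ENNReal.ofReal (K ^ (177/200:ℝ) * (c:ℝ)^(-(101/100):ℝ)) * zs (101/100)) := by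
  rw [block _ c hc]
  have hp : 0 ≤ K ^ (177/200:ℝ) * (c:ℝ)^(-(101/100):ℝ) := by
    have : 0 < K := by linarith
    positivity
  have h1 : ∀ j : ℕ, ∑ r ∈ Finset.range c, ENNReal.ofReal (ff K (c * j + r) * ‖kloos Z ((c * j + r : ℕ) : ℤ) c‖^2)
      ≤ ENNReal.ofReal ((c:ℝ)^2) * ((if j = 0 then 1 else 0) + ENNReal.ofReal (K ^ (177/200:ℝ) * (c:ℝ)^(-(101/100):ℝ)) * az (101/100) j) := by
    intro j
    set g : ℝ := (if j = 0 then 1 else 0) + K ^ (177/200:ℝ) * (c:ℝ)^(-(101/100):ℝ) * (j:ℝ)^(-(101/100):ℝ) with hg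
    have hg0 : 0 ≤ g := (ff_nn _ _).trans (ff_block K hK c j 0 hc)
    rw [← ENNReal.ofReal_sum_of_nonneg (fun r _ => mul_nonneg (ff_nn _ _) (by positivity))]
    have e : ((if j = 0 then 1 else 0) + ENNReal.ofReal (K ^ (177/200:ℝ) * (c:ℝ)^(-(101/100):ℝ)) * az (101/100) j) = ENNReal.ofReal g := by
      unfold az
      rw [← ENNReal.ofReal_mul hp, hg, ENNReal.ofReal_add (by split_ifs <;> norm_num) (by positivity)]
      congr 1
      split_ifs <;> simp
    rw [e, ← ENNReal.ofReal_mul (by positivity)]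
    apply ENNReal.ofReal_le_ofReal
    calc _ ≤ ∑ r ∈ Finset.range c, g * ‖kloos Z (r : ℤ) c‖^2 := by
          apply Finset.sum_le_sum
          intro r _
          rw [kloos_mod]
          have := ff_block K hK c j r hc
          gcongr
      _ = g * ∑ r ∈ Finset.range c, ‖kloos Z (r : ℤ) c‖^2 := by rw [Finset.mul_sum]
      _ ≤ g * (c:ℝ)^2 := by
          gcongr
          exact kloos_parseval Z c hc
      _ = _ := by ring
  refine (ENNReal.tsum_le_tsum h1).trans ?_
  rw [ENNReal.tsum_mul_left, ENNReal.tsum_add, ENNReal.tsum_mul_left, tsum_ite_eq]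
  rfl

noncomputable def C1 : ℝ≥0∞ := zs (101/100) * zs (101/100) + zs (101/100) * (1 + zs (101/100))

lemma C1_ne_top : C1 ≠ ⊤ := by
  have := zs_ne_top (101/100) (by norm_num)
  unfold C1
  finiteness

lemma c_step (K : ℝ) (hK : 2 ≤ K) (c : ℕ) (hc : 1 ≤ c) (hcK : (c:ℝ) ≤ K) (z : ℝ≥0∞) :
   ENNReal.ofReal ((c:ℝ)^(-(9/4):ℝ)) * (ENNReal.ofReal ((c:ℝ)^2) * (1 + ENNReal.ofReal (K ^ (177/200:ℝ) * (c:ℝ)^(-(101/100):ℝ)) * z))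
    ≤ ENNReal.ofReal (K ^ (177/200:ℝ)) * (az (101/100) c * (1 + z)) := by
  have hc0 : (0:ℝ) < c := by exact_mod_cast hc
  have hc1 : (1:ℝ) ≤ c := by exact_mod_cast hc
  have hK0 : 0 < K := by linarith
  have e0 : (c:ℝ)^(-(9/4):ℝ) * (c:ℝ)^2 = (c:ℝ)^(-(1/4):ℝ) := by
    rw [← Real.rpow_natCast, ← Real.rpow_add hc0]; norm_num
  have i1 : (c:ℝ)^(-(1/4):ℝ) ≤ K ^ (177/200:ℝ) * (c:ℝ)^(-(101/100):ℝ) := by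
    rw [show (-(1/4):ℝ) = 76/100 + -(101/100) by norm_num, Real.rpow_add hc0]
    apply mul_le_mul_of_nonneg_right _ (by positivity)
    calc (c:ℝ)^(76/100:ℝ) ≤ K^(76/100:ℝ) := by gcongr
      _ ≤ _ := Real.rpow_le_rpow_of_exponent_le (by linarith) (by norm_num)
  have i2 : (c:ℝ)^(-(1/4):ℝ) ≤ 1 := Real.rpow_le_one_of_one_le_of_nonpos hc1 (by norm_num)
  have e1 : ENNReal.ofReal ((c:ℝ)^(-(9/4):ℝ)) * (ENNReal.ofReal ((c:ℝ)^2) * (1 + ENNReal.ofReal (K ^ (177/200:ℝ) * (c:ℝ)^(-(101/100):ℝ)) * z)) = ENNReal.ofReal ((c:ℝ)^(-(1/4):ℝ)) + ENNReal.ofReal ((c:ℝ)^(-(1/4):ℝ) * (K ^ (177/200:ℝ) * (c:ℝ)^(-(101/100):ℝ))) * z := by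
    rw [← e0, ENNReal.ofReal_mul (p := (c:ℝ)^(-(9/4):ℝ) * (c:ℝ)^2) (by positivity), ENNReal.ofReal_mul (p := (c:ℝ)^(-(9/4):ℝ)) (by positivity)]
    ring
  have e2 : ENNReal.ofReal (K ^ (177/200:ℝ)) * (az (101/100) c * (1 + z)) = ENNReal.ofReal (K ^ (177/200:ℝ) * (c:ℝ)^(-(101/100):ℝ)) + ENNReal.ofReal (K ^ (177/200:ℝ) * (c:ℝ)^(-(101/100):ℝ)) * z := by
    unfold az
    rw [ENNReal.ofReal_mul (by positivity)]
    ring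
  rw [e1, e2]
  have i3 : (c:ℝ)^(-(1/4):ℝ) * (K ^ (177/200:ℝ) * (c:ℝ)^(-(101/100):ℝ)) ≤ K ^ (177/200:ℝ) * (c:ℝ)^(-(101/100):ℝ) :=
    mul_le_of_le_one_left (by positivity) i2
  exact add_le_add (ENNReal.ofReal_le_ofReal i1) (mul_le_mul' (ENNReal.ofReal_le_ofReal i3) le_rfl)

lemma II_sum (K R : ℝ) (hK : 2 ≤ K) (hR : 0 < R) (Z : ℤ) :
    ∑' m : ℕ, ∑' c : ℕ, ENNReal.ofReal (II K R Z m c) ≤ C1 * ENNReal.ofReal (K ^ (177/200:ℝ) * (1 + R)) := by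
  have hK0 : 0 < K := by linarith
  set Q : ℝ≥0∞ := ENNReal.ofReal (K ^ (177/200:ℝ)) with hQ
  set W : ℝ≥0∞ := ENNReal.ofReal (1 + R) with hW
  have h1 : ∀ m c : ℕ, ENNReal.ofReal (II K R Z m c) ≤ W * (Q * (az (101/100) m * az (101/100) c) +
      (if 1 ≤ c ∧ (c:ℝ) ≤ K then ENNReal.ofReal ((c:ℝ)^(-(9/4):ℝ)) else 0) * ENNReal.ofReal (ff K m * ‖kloos Z m c‖^2)) := by
    intro m c
    rcases Nat.eq_zero_or_pos m with h | hm
    · have : II K R Z m c = 0 := by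
        subst h; unfold II; rw [Nat.cast_zero, Real.zero_rpow (by norm_num)]; simp
      rw [this]; simp
    rcases Nat.eq_zero_or_pos c with h | hc
    · have : II K R Z m c = 0 := by
        subst h; unfold II; simp
      rw [this]; simp
    refine (ENNReal.ofReal_le_ofReal (II_le K R hK hR Z m c hm hc)).trans (le_of_eq ?_)
    rw [ENNReal.ofReal_mul (by linarith : (0:ℝ) ≤ 1 + R)]
    congr 1
    rw [ENNReal.ofReal_add (by positivity) (by
      split_ifs
      · exact mul_nonneg (by positivity) (mul_nonneg (ff_nn _ _) (by positivity))
      · exact le_rfl)]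
    unfold az
    congr 1
    · rw [ENNReal.ofReal_mul (by positivity), ENNReal.ofReal_mul (by positivity)]
    have hc' : 1 ≤ c := hc
    simp only [hc', true_and]
    split_ifs
    · rw [ENNReal.ofReal_mul (by positivity)]
    · simp
  have h2 : ∑' m : ℕ, ∑' c : ℕ, (if 1 ≤ c ∧ (c:ℝ) ≤ K then ENNReal.ofReal ((c:ℝ)^(-(9/4):ℝ)) else 0) * ENNReal.ofReal (ff K m * ‖kloos Z m c‖^2) ≤ Q * (zs (101/100) * (1 + zs (101/100))) := by
    rw [ENNReal.tsum_comm]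
    simp_rw [ENNReal.tsum_mul_left]
    have : ∀ c : ℕ, (if 1 ≤ c ∧ (c:ℝ) ≤ K then ENNReal.ofReal ((c:ℝ)^(-(9/4):ℝ)) else 0) * ∑' m : ℕ, ENNReal.ofReal (ff K m * ‖kloos Z m c‖^2) ≤ Q * (az (101/100) c * (1 + zs (101/100))) := by
      intro c
      split_ifs with h
      · refine le_trans ?_ (c_step K hK c h.1 h.2 _)
        gcongr
        exact block_sum K hK Z c h.1
      · simp
    refine (ENNReal.tsum_le_tsum this).trans (le_of_eq ?_)
    rw [ENNReal.tsum_mul_left, ENNReal.tsum_mul_right]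
    rfl
  calc _ ≤ ∑' m : ℕ, ∑' c : ℕ, W * (Q * (az (101/100) m * az (101/100) c) +
      (if 1 ≤ c ∧ (c:ℝ) ≤ K then ENNReal.ofReal ((c:ℝ)^(-(9/4):ℝ)) else 0) * ENNReal.ofReal (ff K m * ‖kloos Z m c‖^2)) :=
        ENNReal.tsum_le_tsum fun m => ENNReal.tsum_le_tsum fun c => h1 m c
    _ = W * (Q * (zs (101/100) * zs (101/100)) + ∑' m : ℕ, ∑' c : ℕ, (if 1 ≤ c ∧ (c:ℝ) ≤ K then ENNReal.ofReal ((c:ℝ)^(-(9/4):ℝ)) else 0) * ENNReal.ofReal (ff K m * ‖kloos Z m c‖^2)) := by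
        simp_rw [ENNReal.tsum_mul_left, ENNReal.tsum_add, ENNReal.tsum_mul_left, ENNReal.tsum_mul_right]
        rfl
    _ ≤ W * (Q * (zs (101/100) * zs (101/100)) + Q * (zs (101/100) * (1 + zs (101/100)))) := by gcongr
    _ = _ := by
        rw [ENNReal.ofReal_mul (by positivity)]
        unfold C1
        ring
end


section

lemma outer (K ε : ℝ) (hK : 2 ≤ K) (he : 0 < ε) (he1 : ε ≤ 1/1000) (α β γ r₁ r₂ n c₂ : ℕ)
   (hα : 0 < α) (hβ : 0 < β) (hγ : 0 < γ) (hr1 : 0 < r₁) (hr2 : 0 < r₂) (hn : 0 < n) (hc : 0 < c₂)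
   (hcond : cond1 K ε r₁ n c₂) (hr : (r₁ : ℝ) / r₂ < K ^ ε) :
   (n:ℝ)^(-(1/2):ℝ) * (xx r₁ n c₂)^(-(1/2):ℝ) * (K^2/(xi α β γ r₂ n))^3 * (1 + (n:ℝ)*α*β^2/K^2) ≤
     2 * K^(1/50:ℝ) * ((n:ℝ)^(-(201/200):ℝ) * (c₂:ℝ)^(-(201/200):ℝ)) := by
  have hK0 : 0 < K := by linarith
  have hK1 : 1 ≤ K := by linarith
  have a1 : (1:ℝ) ≤ α := by exact_mod_cast hα
  have b1 : (1:ℝ) ≤ β := by exact_mod_cast hβ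
  have g1 : (1:ℝ) ≤ γ := by exact_mod_cast hγ
  have r11 : (1:ℝ) ≤ r₁ := by exact_mod_cast hr1
  have r21 : (1:ℝ) ≤ r₂ := by exact_mod_cast hr2
  have n1 : (1:ℝ) ≤ n := by exact_mod_cast hn
  have c1 : (1:ℝ) ≤ c₂ := by exact_mod_cast hc
  have n0 : (0:ℝ) < n := by linarith
  have c0 : (0:ℝ) < c₂ := by linarith
  unfold cond1 at hcond
  set R : ℝ := (n:ℝ)*α*β^2/K^2 with hR
  set u : ℝ := K^2/(xi α β γ r₂ n) with hu
  set x : ℝ := xx r₁ n c₂ with hx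
  set N : ℝ := n * r₁ / K^2 with hN
  have N0 : 0 < N := by positivity
  have R0 : 0 < R := by positivity
  have xi0 : 0 < xi α β γ r₂ n := by unfold xi; positivity
  have u0 : 0 < u := by positivity
  have hx1 : K^((2:ℝ) - ε) ≤ x := by
    refine hcond.le.trans ?_
    rw [hx]; unfold xx
    have : (n:ℝ) * r₁ / c₂ ≤ 4 * Real.pi * (n * r₁ / c₂) := by
      apply le_mul_of_one_le_left (by positivity)
      have := Real.pi_gt_three
      linarith
    refine this.trans (le_of_eq ?_)
    ring
  have hxx : x^(-(1/2):ℝ) ≤ K^(-1 + ε/2) := by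
    calc x^(-(1/2):ℝ) ≤ (K^((2:ℝ) - ε))^(-(1/2):ℝ) :=
          Real.rpow_le_rpow_of_nonpos (by positivity) hx1 (by norm_num)
      _ = _ := by rw [← Real.rpow_mul hK0.le]; congr 1; ring
  have hcN : (c₂:ℝ) ≤ N * K^ε := by
    have h := hcond.le
    rw [le_div_iff₀ c0, Real.rpow_sub hK0] at h
    norm_cast at h
    have hke : 0 < K^ε := by positivity
    have h2 : K^2 * c₂ ≤ n * r₁ * K^ε := by
      have := mul_le_mul_of_nonneg_right h hke.le
      calc K^2 * (c₂:ℝ) = K^2 / K^ε * c₂ * K^ε := by field_simp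
        _ ≤ _ := by exact_mod_cast this
    rw [hN, div_mul_eq_mul_div, le_div_iff₀ (by positivity)]
    linarith
  have hNK : K^(-ε) ≤ N := by
    rw [Real.rpow_neg hK0.le, inv_le_iff_one_le_mul₀ (by positivity)]
    linarith
  have huN : u ≤ K^ε / N := by
    have h1 : u ≤ K^2 / (n * r₂) := by
      rw [hu]; unfold xi
      apply div_le_div_of_nonneg_left (by positivity) (by positivity)
      calc (n:ℝ) * r₂ = n * (r₂ * 1) * 1 * 1 * 1 := by ring
        _ ≤ n * (r₂ * r₂) * α^3 * β^2 * γ^2 := by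
            gcongr <;> exact one_le_pow₀ (by assumption)
        _ = _ := by ring
    refine h1.trans ?_
    rw [div_lt_iff₀ (by linarith)] at hr
    rw [hN, div_div_eq_mul_div, div_le_div_iff₀ (by positivity) (by positivity)]
    calc K^2 * (n * r₁) ≤ K^2 * (n * (K^ε * r₂)) := by gcongr
      _ = _ := by ring
  have hNinv : N⁻¹ ≤ K^ε := by
    rw [Real.rpow_neg hK0.le] at hNK
    exact inv_le_of_inv_le₀ (by positivity) hNK
  have hu2 : u ≤ K^(2*ε) := by
    refine huN.trans ?_
    rw [two_mul, Real.rpow_add hK0, div_eq_mul_inv]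
    gcongr
  have huR : u * R ≤ 1 := by
    have : u * R = 1 / (r₂^2 * α^2 * γ^2) := by
      rw [hu, hR]; unfold xi; field_simp
    rw [this, div_le_one (by positivity)]
    calc (1:ℝ) = 1 * 1 * 1 := by norm_num
      _ ≤ _ := by gcongr <;> exact one_le_pow₀ (by assumption)
  have hK2 : 1 ≤ K^(2*ε) := Real.one_le_rpow hK1 (by positivity)
  have huu : u * (1 + R) ≤ 2 * K^(2*ε) := by linarith
  have key : (n:ℝ)^(-(1/2):ℝ) ≤ ((n:ℝ)^(-(201/200):ℝ) * (c₂:ℝ)^(-(201/200):ℝ)) * (N^(151/100:ℝ) * K^(101/100 + 201/200*ε)) := by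
    have hnN : (n:ℝ) ≤ N * K^2 := by
      rw [hN, div_mul_cancel₀ _ (by positivity)]
      exact le_mul_of_one_le_right n0.le r11
    calc (n:ℝ)^(-(1/2):ℝ) = ((n:ℝ)^(-(201/200):ℝ) * (n:ℝ)^(101/200:ℝ)) * ((c₂:ℝ)^(-(201/200):ℝ) * (c₂:ℝ)^(201/200:ℝ)) := by
          rw [← Real.rpow_add n0, ← Real.rpow_add c0]; norm_num
      _ ≤ ((n:ℝ)^(-(201/200):ℝ) * (N * K^2)^(101/200:ℝ)) * ((c₂:ℝ)^(-(201/200):ℝ) * (N * K^ε)^(201/200:ℝ)) := by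
          gcongr
      _ = ((n:ℝ)^(-(201/200):ℝ) * (c₂:ℝ)^(-(201/200):ℝ)) * ((N^(101/200:ℝ) * N^(201/200:ℝ)) * ((K^(101/100:ℝ) * K^(201/200*ε)))) := by
          rw [Real.mul_rpow N0.le (by positivity), Real.mul_rpow N0.le (by positivity), ← Real.rpow_natCast K 2, ← Real.rpow_mul hK0.le, ← Real.rpow_mul hK0.le]
          rw [show ((2:ℕ):ℝ) * (101/200) = 101/100 by norm_num, mul_comm ε]
          ring
      _ ≤ ((n:ℝ)^(-(201/200):ℝ) * (c₂:ℝ)^(-(201/200):ℝ)) * (N^(151/100:ℝ) * K^(101/100 + 201/200*ε)) := by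
          rw [← Real.rpow_add N0, ← Real.rpow_add hK0]; norm_num
  have hN49 : N^(151/100:ℝ) * (K^ε / N)^2 ≤ K^(249/100*ε) := by
    calc N^(151/100:ℝ) * (K^ε / N)^2 = (N^(151/100:ℝ) * N^(-2:ℝ)) * K^(2*ε) := by
          rw [Real.rpow_neg N0.le, mul_comm 2 ε, Real.rpow_mul hK0.le]; norm_cast; field_simp
      _ = (N⁻¹)^(49/100:ℝ) * K^(2*ε) := by
          rw [← Real.rpow_add N0, Real.inv_rpow N0.le, ← Real.rpow_neg N0.le]; norm_num
      _ ≤ (K^ε)^(49/100:ℝ) * K^(2*ε) := by gcongr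
      _ = _ := by rw [← Real.rpow_mul hK0.le, ← Real.rpow_add hK0]; congr 1; ring
  set P := (n:ℝ)^(-(201/200):ℝ) * (c₂:ℝ)^(-(201/200):ℝ) with hP
  have P0 : 0 < P := by positivity
  have x0 : 0 ≤ x^(-(1/2):ℝ) := Real.rpow_nonneg (le_trans (by positivity) hx1) _
  calc (n:ℝ)^(-(1/2):ℝ) * x^(-(1/2):ℝ) * u^3 * (1 + R) = (n:ℝ)^(-(1/2):ℝ) * x^(-(1/2):ℝ) * u^2 * (u * (1 + R)) := by ring
    _ ≤ (P * (N^(151/100:ℝ) * K^(101/100 + 201/200*ε))) * K^(-1 + ε/2) * (K^ε/N)^2 * (2 * K^(2*ε)) := by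
        gcongr
    _ = 2 * ((N^(151/100:ℝ) * (K^ε / N)^2) * (K^(101/100 + 201/200*ε) * K^(-1 + ε/2) * K^(2*ε))) * P := by ring
    _ ≤ 2 * (K^(249/100*ε) * (K^(101/100 + 201/200*ε) * K^(-1 + ε/2) * K^(2*ε))) * P := by gcongr
    _ ≤ 2 * K^(1/50:ℝ) * P := by
        rw [← Real.rpow_add hK0, ← Real.rpow_add hK0, ← Real.rpow_add hK0]
        have : K ^ (249 / 100 * ε + (101 / 100 + 201 / 200 * ε + (-1 + ε / 2) + 2 * ε)) ≤ K^(1/50:ℝ) :=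
          Real.rpow_le_rpow_of_exponent_le hK1 (by linarith)
        gcongr

lemma pt_bound (K ε : ℝ) (hK : 2 ≤ K) (he : 0 < ε) (he1 : ε ≤ 1/1000) (α β γ r₁ r₂ n m c₁ c₂ : ℕ)
   (hα : 0 < α) (hβ : 0 < β) (hγ : 0 < γ) (hr1 : 0 < r₁) (hr2 : 0 < r₂) (hn : 0 < n) (hm : 0 < m) (hc1 : 0 < c₁) (hc : 0 < c₂)
   (hcond : cond1 K ε r₁ n c₂) (hr : (r₁ : ℝ) / r₂ < K ^ ε) :
   (1 / Real.sqrt ((n:ℝ)*m)) * (‖kloos ((n:ℤ)*α*β^2) (m:ℤ) c₁‖ / c₁) * (K^ε * (xx r₁ n c₂)^(-(1/2):ℝ) * min 1 ((K/m)^2) * (K^2/(xi α β γ r₂ n))^3 * min 1 ((yy α β n m c₁ / K)^2))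
   ≤ 320 * K^(21/1000:ℝ) * ((n:ℝ)^(-(201/200):ℝ) * (c₂:ℝ)^(-(201/200):ℝ)) * ((1 + (n:ℝ)*α*β^2/K^2)⁻¹ * II K ((n:ℝ)*α*β^2/K^2) ((n:ℤ)*α*β^2) m c₁) := by
  have hK0 : 0 < K := by linarith
  have ho := outer K ε hK he he1 α β γ r₁ r₂ n c₂ hα hβ hγ hr1 hr2 hn hc hcond hr
  have n0 : (0:ℝ) < n := by exact_mod_cast hn
  have m0 : (0:ℝ) < m := by exact_mod_cast hm
  have c10 : (0:ℝ) < c₁ := by exact_mod_cast hc1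
  have c20 : (0:ℝ) < c₂ := by exact_mod_cast hc
  have a0 : (0:ℝ) < α := by exact_mod_cast hα
  have b0 : (0:ℝ) < β := by exact_mod_cast hβ
  set R : ℝ := (n:ℝ)*α*β^2/K^2 with hR
  have R0 : 0 < R := by positivity
  set P := (n:ℝ)^(-(201/200):ℝ) * (c₂:ℝ)^(-(201/200):ℝ) with hP
  have hke : K^ε * K^(1/50:ℝ) ≤ K^(21/1000:ℝ) := by
    rw [← Real.rpow_add hK0]
    exact Real.rpow_le_rpow_of_exponent_le (by linarith) (by linarith)
  have hs : 1 / Real.sqrt ((n:ℝ)*m) = (n:ℝ)^(-(1/2):ℝ) * (m:ℝ)^(-(1/2):ℝ) := by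
    rw [← Real.mul_rpow n0.le m0.le, Real.rpow_neg (by positivity), Real.sqrt_eq_rpow, one_div]
  have hy : min 1 ((yy α β n m c₁ / K)^2) ≤ 160 * min 1 (R*m/c₁^2) := by
    have e : (yy α β n m c₁ / K)^2 = 16 * Real.pi^2 * (R*m/c₁^2) := by
      unfold yy
      rw [div_pow, div_pow, mul_pow, Real.sq_sqrt (by positivity), hR]
      field_simp
      ring
    have hpi : 16 * Real.pi^2 ≤ 160 := by
      have := Real.pi_lt_d2
      nlinarith [Real.pi_pos]
    have t0 : 0 < R*m/c₁^2 := by positivity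
    rcases le_total 1 (R*m/c₁^2) with h | h
    · rw [min_eq_left h]; exact (min_le_left _ _).trans (by norm_num)
    · rw [min_eq_right h, e]
      exact (min_le_right _ _).trans (by gcongr)
  have x0 : 0 ≤ xx r₁ n c₂ := by unfold xx; positivity
  have xi0 : 0 ≤ xi α β γ r₂ n := by unfold xi; positivity
  have II0 : 0 ≤ II K R ((n:ℤ)*α*β^2) m c₁ := by unfold II; positivity
  calc _ ≤ ((n:ℝ)^(-(1/2):ℝ) * (m:ℝ)^(-(1/2):ℝ)) * (‖kloos ((n:ℤ)*α*β^2) (m:ℤ) c₁‖ / c₁) * (K^ε * (xx r₁ n c₂)^(-(1/2):ℝ) * min 1 ((K/m)^2) * (K^2/(xi α β γ r₂ n))^3 * (160 * min 1 (R*m/c₁^2))) := by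
        rw [hs]; gcongr
    _ = 160 * K^ε * ((n:ℝ)^(-(1/2):ℝ) * (xx r₁ n c₂)^(-(1/2):ℝ) * (K^2/(xi α β γ r₂ n))^3 * (1 + R)) * ((1 + R)⁻¹ * II K R ((n:ℤ)*α*β^2) m c₁) := by
        unfold II
        have : (1 + R) ≠ 0 := by positivity
        field_simp
    _ ≤ 160 * K^ε * (2 * K^(1/50:ℝ) * P) * ((1 + R)⁻¹ * II K R ((n:ℤ)*α*β^2) m c₁) := by gcongr
    _ = 320 * (K^ε * K^(1/50:ℝ)) * P * ((1 + R)⁻¹ * II K R ((n:ℤ)*α*β^2) m c₁) := by ring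
    _ ≤ _ := by gcongr
end


section

noncomputable def Bd (A K : ℝ) (α β : ℕ) (n m c₁ c₂ : ℕ) : ENNReal :=
  (ENNReal.ofReal (A * (320 * K^(21/1000:ℝ))) * (az (201/200) n * ENNReal.ofReal ((1 + (n:ℝ)*α*β^2/K^2)⁻¹))) * (ENNReal.ofReal (II K ((n:ℝ)*α*β^2/K^2) ((n:ℤ)*α*β^2) m c₁) * az (201/200) c₂)

lemma Bd_sum (A K : ℝ) (hK : 2 ≤ K) (α β : ℕ) (hα : 0 < α) (hβ : 0 < β) :
    ∑' n, ∑' m, ∑' c₁, ∑' c₂, Bd A K α β n m c₁ c₂ ≤ ENNReal.ofReal (A * (320 * K^(21/1000:ℝ))) * ENNReal.ofReal (K^(177/200:ℝ)) * (zs (201/200) * zs (201/200) * C1) := by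
  have hK0 : 0 < K := by linarith
  have a0 : (0:ℝ) < α := by exact_mod_cast hα
  have b0 : (0:ℝ) < β := by exact_mod_cast hβ
  unfold Bd
  simp_rw [ENNReal.tsum_mul_left, ENNReal.tsum_mul_right]
  rw [show (∑' c₂, az (201/200) c₂) = zs (201/200) from rfl]
  have : ∀ n : ℕ, ENNReal.ofReal (A * (320 * K^(21/1000:ℝ))) * (az (201/200) n * ENNReal.ofReal ((1 + (n:ℝ)*α*β^2/K^2)⁻¹)) * ((∑' m : ℕ, ∑' c₁ : ℕ, ENNReal.ofReal (II K ((n:ℝ)*α*β^2/K^2) ((n:ℤ)*α*β^2) m c₁)) * zs (201/200))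
     ≤ az (201/200) n * (ENNReal.ofReal (A * (320 * K^(21/1000:ℝ))) * ENNReal.ofReal (K^(177/200:ℝ)) * (zs (201/200) * C1)) := by
    intro n
    rcases Nat.eq_zero_or_pos n with h | h
    · have : az (201/200) n = 0 := by
        subst h; unfold az; rw [Nat.cast_zero, Real.zero_rpow (by norm_num)]; simp
      rw [this]; simp
    have n0 : (0:ℝ) < n := by exact_mod_cast h
    set R : ℝ := (n:ℝ)*α*β^2/K^2 with hR
    have R0 : 0 < R := by positivity
    have hI := II_sum K R hK R0 ((n:ℤ)*α*β^2)
    have e : ENNReal.ofReal ((1 + R)⁻¹) * ENNReal.ofReal (K ^ (177/200:ℝ) * (1 + R)) = ENNReal.ofReal (K ^ (177/200:ℝ)) := by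
      rw [← ENNReal.ofReal_mul (by positivity)]
      congr 1
      field_simp
    calc _ ≤ ENNReal.ofReal (A * (320 * K^(21/1000:ℝ))) * (az (201/200) n * ENNReal.ofReal ((1 + R)⁻¹)) * ((C1 * ENNReal.ofReal (K ^ (177/200:ℝ) * (1 + R))) * zs (201/200)) := by gcongr
      _ = az (201/200) n * (ENNReal.ofReal (A * (320 * K^(21/1000:ℝ))) * (ENNReal.ofReal ((1 + R)⁻¹) * ENNReal.ofReal (K ^ (177/200:ℝ) * (1 + R))) * (zs (201/200) * C1)) := by ring
      _ = _ := by rw [e]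
  refine (ENNReal.tsum_le_tsum this).trans (le_of_eq ?_)
  rw [ENNReal.tsum_mul_right, show (∑' c₂, az (201/200) c₂) = zs (201/200) from rfl]
  ring

lemma lvl (N : ℕ) (G : ℕ → ℕ → ℂ) (B : ℕ → ENNReal) (hB : ∑' n, B n ≠ ⊤)
    (h : ∀ s, Adm N s → ∀ n, ‖∑ l ∈ s, G l n‖ₑ ≤ B n) :
    ∀ s, Adm N s → ‖∑ l ∈ s, ∑' n, G l n‖ₑ ≤ ∑' n, B n := by
  have hs : ∀ l < N, Summable (G l) := by
    intro l hl
    have h1 : ∀ n, ‖G l n‖ₑ ≤ B n := fun n => by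
      have := h {l} (Or.inr ⟨l, hl, rfl⟩) n
      simpa using this
    have : Summable (fun n => ‖G l n‖) :=
      tsum_enorm_ne_top_iff_summable_norm.1 (ne_top_of_le_ne_top hB (ENNReal.tsum_le_tsum h1))
    exact this.of_norm
  intro s hsA
  have hmem : ∀ l ∈ s, Summable (G l) := by
    intro l hl
    apply hs
    rcases hsA with rfl | ⟨l', hl', rfl⟩
    · exact Finset.mem_range.1 hl
    · rw [Finset.mem_singleton.1 hl]; exact hl'
  rw [← Summable.tsum_finsetSum hmem]
  exact (enorm_tsum_le_tsum_enorm).trans (ENNReal.tsum_le_tsum (h s hsA))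

lemma lvl4 (N : ℕ) (G : ℕ → ℕ → ℕ → ℕ → ℕ → ℂ) (B : ℕ → ℕ → ℕ → ℕ → ENNReal) (hB : ∑' n, ∑' m, ∑' c, ∑' d, B n m c d ≠ ⊤)
    (h : ∀ s, Adm N s → ∀ n m c d, ‖∑ l ∈ s, G l n m c d‖ₑ ≤ B n m c d) :
    ‖∑ l ∈ Finset.range N, ∑' n, ∑' m, ∑' c, ∑' d, G l n m c d‖ₑ ≤ ∑' n, ∑' m, ∑' c, ∑' d, B n m c d := by
  refine lvl N (fun l n => ∑' m, ∑' c, ∑' d, G l n m c d) _ hB ?_ _ (Or.inl rfl)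
  intro s hs n
  have hB1 := ENNReal.ne_top_of_tsum_ne_top hB n
  refine lvl N (fun l m => ∑' c, ∑' d, G l n m c d) _ hB1 ?_ s hs
  intro s hs m
  have hB2 := ENNReal.ne_top_of_tsum_ne_top hB1 m
  refine lvl N (fun l c => ∑' d, G l n m c d) _ hB2 ?_ s hs
  intro s hs c
  have hB3 := ENNReal.ne_top_of_tsum_ne_top hB2 c
  exact lvl N (fun l d => G l n m c d) _ hB3 (fun s hs d => h s hs n m c d) s hs

lemma Lg_le (K : ℝ) (hK : 2 ≤ K) : 1 + 4 * Real.log (1 + (⌈K⌉₊ : ℝ)) ≤ 405 * K^(1/100:ℝ) := by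
  have h1 := N_le K hK
  have hK0 : 0 < K := by linarith
  have h2 : Real.log (1 + (⌈K⌉₊ : ℝ)) ≤ Real.log (2 * K) := by
    apply Real.log_le_log (by positivity); linarith
  rw [Real.log_mul (by norm_num) hK0.ne'] at h2
  have h3 := Real.log_two_lt_d9
  have h4 := Real.log_le_rpow_div hK0.le (by norm_num : (0:ℝ) < 1/100)
  have h5 : 1 ≤ K^(1/100:ℝ) := Real.one_le_rpow (by linarith) (by norm_num)
  rw [div_eq_mul_inv] at h4
  norm_num at h4 h5 ⊢
  linarith

lemma k_red (K : ℝ) (hK : 2 ≤ K) (X : ℕ → ℂ) (hX : ∀ k : ℕ, 2 * K ≤ k → X k = 0) :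
    (∑' k : ℕ, if Even k ∧ 2 ≤ k then X k else 0) = ∑ l ∈ Finset.range ⌈K⌉₊, X (2*l+2) := by
  rw [tsum_eq_sum (s := (Finset.range ⌈K⌉₊).image (fun l => 2*l+2)), Finset.sum_image]
  · apply Finset.sum_congr rfl
    intro l _
    rw [if_pos]
    exact ⟨⟨l+1, by ring⟩, by omega⟩
  · intro a _ b _ h
    simp only at h
    omega
  · intro k hk
    split_ifs with h
    · apply hX
      obtain ⟨⟨j, rfl⟩, h2⟩ := h
      simp only [Finset.mem_image, Finset.mem_range, not_exists, not_and] at hk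
      have h3 : ⌈K⌉₊ ≤ j - 1 := by
        by_contra hlt
        exact hk (j-1) (by omega) (by omega)
      have h4 : K ≤ ((j - 1 : ℕ) : ℝ) := Nat.ceil_le.1 h3
      have h5 : ((j - 1 : ℕ) : ℝ) ≤ j := by exact_mod_cast Nat.sub_le _ _
      push_cast
      linarith
    · rfl
end

open scoped Classical in
theorem stmt6 (w : ℝ → ℝ)
    (hsm : ContDiff ℝ (⊤ : ℕ∞) w) (hnn : ∀ u, 0 ≤ w u)
    (hsupp : Function.support w ⊆ Set.Ioo 1 2)
    (hbd : ∀ B : ℕ, ∃ M : ℝ, ∀ u, |iteratedDeriv B w u| ≤ M) :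
    ∃ ε₀ : ℝ, 0 < ε₀ ∧ ∀ ε : ℝ, 0 < ε → ε < ε₀ →
    ∃ C : ℝ, ∀ K : ℝ, 2 ≤ K → ∀ α β γ r₁ r₂ : ℕ,
      0 < α → 0 < β → 0 < γ → 0 < r₁ → 0 < r₂ →
      K ^ (-ε) < (r₁ : ℝ) / r₂ → (r₁ : ℝ) / r₂ < K ^ ε →
      ‖((1 / (Real.pi * K) : ℝ) : ℂ) *
        ∑' k : ℕ, if Even k ∧ 2 ≤ k then
          ∑' n : ℕ, ∑' m : ℕ, ∑' c₁ : ℕ, ∑' c₂ : ℕ,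
            (if 1 ≤ n ∧ 1 ≤ m ∧ 1 ≤ c₁ ∧ 1 ≤ c₂ ∧ cond1 K ε r₁ n c₂ then
              T w K α β γ r₁ r₂ k n m c₁ c₂ else 0)
        else 0‖ ≤ C * K ^ (-(1/13 : ℝ)) := by
  obtain ⟨C, hC, hks⟩ := k_sum w hsm hsupp hbd
  refine ⟨1/1000, by norm_num, ?_⟩
  intro ε he he1
  set Zc : ENNReal := zs (201/200) * zs (201/200) * C1 with hZc
  have hZt : Zc ≠ ⊤ := by
    have h1 := zs_ne_top (201/200) (by norm_num)
    have h2 := C1_ne_top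
    rw [hZc]
    finiteness
  refine ⟨C * 405 * 320 * Zc.toReal, ?_⟩
  intro K hK α β γ r₁ r₂ hα hβ hγ hr1 hr2 _ hr
  have hK0 : 0 < K := by linarith
  have hK1 : 1 ≤ K := by linarith
  have hLg := Lg_le K hK
  set A : ℝ := C * (405 * K^(1/100:ℝ)) with hA
  have hA0 : 0 ≤ A := by positivity
  rw [k_red K hK]
  swap
  · intro k hk
    have hw : w ((k:ℝ)/K) = 0 := by
      by_contra hne
      have := (hsupp hne).2
      rw [div_lt_iff₀ hK0] at this
      linarith
    have hT : ∀ n m c₁ c₂, T w K α β γ r₁ r₂ k n m c₁ c₂ = 0 := by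
      intro n m c₁ c₂
      unfold T
      rw [hw]
      simp
    simp [hT]
  have hsum := Bd_sum A K hK α β hα hβ
  have hfin : ENNReal.ofReal (A * (320 * K^(21/1000:ℝ))) * ENNReal.ofReal (K^(177/200:ℝ)) * Zc ≠ ⊤ := by
    finiteness
  have hmain := lvl4 ⌈K⌉₊ (fun l n m c₁ c₂ => if 1 ≤ n ∧ 1 ≤ m ∧ 1 ≤ c₁ ∧ 1 ≤ c₂ ∧ cond1 K ε r₁ n c₂ then
              T w K α β γ r₁ r₂ (2*l+2) n m c₁ c₂ else 0) (Bd A K α β) (ne_top_of_le_ne_top hfin hsum) (by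
    intro s hs n m c₁ c₂
    by_cases h : 1 ≤ n ∧ 1 ≤ m ∧ 1 ≤ c₁ ∧ 1 ≤ c₂ ∧ cond1 K ε r₁ n c₂
    · simp only [if_pos h]
      obtain ⟨hn, hm, hc1, hc2, hc⟩ := h
      have b1 := hks K ε hK he (by linarith) α β γ r₁ r₂ n m c₁ c₂ hα hβ hγ hr1 hr2 hn hm hc1 hc2 hc s hs
      have b2 := pt_bound K ε hK he he1.le α β γ r₁ r₂ n m c₁ c₂ hα hβ hγ hr1 hr2 hn hm hc1 hc2 hc hr
      have b3 : C * (1 + 4 * Real.log (1 + (⌈K⌉₊:ℝ))) ≤ A := mul_le_mul_of_nonneg_left hLg hC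
      have xi0 : 0 ≤ xi α β γ r₂ n := by unfold xi; positivity
      have xx0 : 0 ≤ xx r₁ n c₂ := by unfold xx; positivity
      have II0 : 0 ≤ II K ((n:ℝ)*α*β^2/K^2) ((n:ℤ)*α*β^2) m c₁ := by unfold II; positivity
      have b4 := b1.trans (mul_le_mul b3 b2 (by positivity) hA0)
      rw [← ofReal_norm]
      refine (ENNReal.ofReal_le_ofReal b4).trans (le_of_eq ?_)
      unfold Bd az
      rw [← ENNReal.ofReal_mul (by positivity), ← ENNReal.ofReal_mul (by positivity), ← ENNReal.ofReal_mul (by positivity), ← ENNReal.ofReal_mul (by positivity)]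
      congr 1
      ring
    · simp only [if_neg h, Finset.sum_const_zero, enorm_zero]
      exact zero_le)
  have h2 := hmain.trans hsum
  rw [← hZc, ← ENNReal.ofReal_toReal hZt, ← ENNReal.ofReal_mul (by positivity), ← ENNReal.ofReal_mul (by positivity), ← ofReal_norm, ENNReal.ofReal_le_ofReal_iff (by positivity)] at h2
  rw [norm_mul, Complex.norm_real, Real.norm_of_nonneg (by positivity)]
  have hpi : 1 / (Real.pi * K) ≤ K^(-1:ℝ) := by
    rw [Real.rpow_neg_one, ← one_div]
    apply one_div_le_one_div_of_le hK0
    have := Real.pi_gt_three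
    nlinarith
  refine (mul_le_mul hpi h2 (norm_nonneg _) (by positivity)).trans ?_
  have hpow : K^(-1:ℝ) * (K^(1/100:ℝ) * K^(21/1000:ℝ) * K^(177/200:ℝ)) ≤ K^(-(1/13:ℝ)) := by
    rw [← Real.rpow_add hK0, ← Real.rpow_add hK0, ← Real.rpow_add hK0]
    exact Real.rpow_le_rpow_of_exponent_le hK1 (by norm_num)
  calc _ = C * 405 * 320 * Zc.toReal * (K^(-1:ℝ) * (K^(1/100:ℝ) * K^(21/1000:ℝ) * K^(177/200:ℝ))) := by
        rw [hA]; ring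
    _ ≤ _ := by gcongr
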